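/- arXiv:2307.12840 — 4 statements merged into one kernel-verified Lean document; each statement's English description precedes it below -/
import Mathlib

section
/- The sum over even m ≥ D+1 of c_m^2 is O(D^{-3/2}): there is a constant K such that for all D ≥ 1, Σ_{m > D, m even} c_m^2 ≤ K·D^{-3/2}, where c_m = E[ReLU(G) h_m(G)] for G ~ N(0,1). -/
open MeasureTheory ProbabilityTheory

/-- The `m`-th normalized probabilist's Hermite polynomial `h_m(t) = He_m(t)/√(m!)`. -/
noncomputable def hermiteN (m : ℕ) (t : ℝ) : ℝ :=
  (Polynomial.aeval t (Polynomial.hermite m)) / Real.sqrt (Nat.factorial m)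

/-- `c_m = E_{G ~ N(0,1)}[ReLU(G) h_m(G)]`. -/
noncomputable def reluCoeff (m : ℕ) : ℝ :=
  ∫ t, max 0 t * hermiteN m t ∂(gaussianReal 0 1)

open Polynomial in
lemma integrable_aeval_mul_exp (p : ℤ[X]) :
    Integrable fun t : ℝ => aeval t p * Real.exp (-(t ^ 2 / 2)) := by
  induction p using Polynomial.induction_on' with
  | add p q hp hq => simpa only [map_add, add_mul] using! hp.add hq
  | monomial n a =>
    have h := integrable_rpow_mul_exp_neg_mul_sq (b := 1 / 2) (by norm_num) (s := n)
      (by linarith [n.cast_nonneg (α := ℝ)])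
    refine (h.const_mul (a : ℝ)).congr (.of_forall fun t => ?_)
    simp only [Real.rpow_natCast, aeval_monomial, eq_intCast, mul_assoc]
    congr 3
    ring

open Polynomial in
lemma hasDerivAt_aeval_mul_exp (p : ℤ[X]) (t : ℝ) :
    HasDerivAt (fun t : ℝ => aeval t p * Real.exp (-(t ^ 2 / 2)))
      (-(aeval t (X * p - derivative p) * Real.exp (-(t ^ 2 / 2)))) t := by
  have h1 : HasDerivAt (fun t : ℝ => Real.exp (-(t ^ 2 / 2)))
      (Real.exp (-(t ^ 2 / 2)) * -(2 * t / 2)) t := by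
    simpa using (((hasDerivAt_id t).pow 2).div_const 2).neg.exp
  refine ((p.hasDerivAt_aeval t).fun_mul h1).congr_deriv ?_
  simp only [map_sub, map_mul, aeval_X]
  ring

open Polynomial in
lemma integral_Ioi_aeval_mul_exp (p : ℤ[X]) :
    ∫ t in Set.Ioi (0 : ℝ), aeval t (X * p - derivative p) * Real.exp (-(t ^ 2 / 2)) =
      aeval (0 : ℝ) p := by
  have h_int := (integrable_aeval_mul_exp (X * p - derivative p)).neg.integrableOn
    (s := Set.Ioi 0)
  have hlim := tendsto_zero_of_hasDerivAt_of_integrableOn_Ioi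
    (fun t _ => hasDerivAt_aeval_mul_exp p t) h_int
    (integrable_aeval_mul_exp p).integrableOn
  have h := integral_Ioi_of_hasDerivAt_of_tendsto'
    (fun t _ => hasDerivAt_aeval_mul_exp p t) h_int hlim
  rw [integral_neg] at h
  simpa using h

open Polynomial in
lemma reluCoeff_add_two (m : ℕ) :
    reluCoeff (m + 2) =
      (√(2 * Real.pi))⁻¹ * ((hermite m).coeff 0 : ℝ) / √((m + 2).factorial) := by
  have hq : X * hermite (m + 2) = X * (X * hermite (m + 1) + hermite m) -
      derivative (X * hermite (m + 1) + hermite m) := by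
    simp only [hermite_succ, derivative_add, derivative_mul, derivative_X, derivative_sub]
    ring
  have h := integral_Ioi_aeval_mul_exp (X * hermite (m + 1) + hermite m)
  rw [← hq] at h
  have h0 : aeval (0 : ℝ) (X * hermite (m + 1) + hermite m) = ((hermite m).coeff 0 : ℝ) := by
    have h := coeff_zero_eq_aeval_zero' (A := ℝ) (hermite m)
    simpa using h.symm
  rw [h0, ← integral_indicator measurableSet_Ioi] at h
  rw [reluCoeff, integral_gaussianReal_eq_integral_smul one_ne_zero, ← h, mul_div_assoc,
    ← integral_div, ← integral_const_mul]
  congr 1 with t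
  rcases le_or_gt t 0 with ht | ht
  · simp [ht]
  · simp only [gaussianPDFReal, hermiteN, Set.mem_Ioi, ht, Set.indicator_of_mem,
      max_eq_right ht.le, map_mul, aeval_X, smul_eq_mul, NNReal.coe_one, mul_one, sub_zero,
      neg_div]
    ring

open scoped Nat in
lemma reluCoeff_sq_succ (k : ℕ) :
    reluCoeff (2 * (k + 1) + 2) ^ 2 * ((2 * k + 3) * (2 * k + 4)) =
      reluCoeff (2 * k + 2) ^ 2 * (2 * k + 1) ^ 2 := by
  have key (k : ℕ) : reluCoeff (2 * k + 2) ^ 2 =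
      (2 * Real.pi)⁻¹ * ((2 * k - 1)‼ : ℝ) ^ 2 / (2 * k + 2)! := by
    rw [reluCoeff_add_two, Polynomial.coeff_hermite_of_even_add (by simp), div_pow, mul_pow,
      inv_pow, Real.sq_sqrt (by positivity), Real.sq_sqrt (by positivity)]
    simp [mul_pow, ← pow_mul, mul_comm _ 2]
  rw [key, key]
  have h1 : (2 * (k + 1) - 1)‼ = (2 * k + 1) * (2 * k - 1)‼ := by
    cases k with
    | zero => simp
    | succ n => exact Nat.doubleFactorial_add_two (2 * n + 1)
  have h2 : (2 * (k + 1) + 2)! = (2 * k + 4) * ((2 * k + 3) * (2 * k + 2)!) := by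
    rw [show 2 * (k + 1) + 2 = 2 * k + 2 + 1 + 1 by ring, Nat.factorial_succ, Nat.factorial_succ]
  rw [h1, h2]
  push_cast
  have : ((2 * k + 2)! : ℝ) ≠ 0 := by positivity
  field_simp

lemma reluCoeff_sq_telescope (k : ℕ) :
    reluCoeff (2 * k + 2) ^ 2 + ((k + 1 : ℕ) + 2) * reluCoeff (2 * (k + 1) + 2) ^ 2 ≤
      (k + 2) * reluCoeff (2 * k + 2) ^ 2 := by
  have h := reluCoeff_sq_succ k
  have ha := sq_nonneg (reluCoeff (2 * k + 2))
  rw [← eq_div_iff (by positivity)] at h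
  rw [h]
  generalize reluCoeff (2 * k + 2) ^ 2 = a at ha
  rw [← mul_div_assoc, ← le_sub_iff_add_le', div_le_iff₀ (by positivity)]
  push_cast
  have : 0 ≤ a * (2 * k ^ 2 + 13 * k + 9) := by positivity
  linarith

lemma reluCoeff_sq_sq_mul_le (k : ℕ) :
    (reluCoeff (2 * k + 2) ^ 2) ^ 2 * (k + 1) ^ 5 ≤ 1 := by
  induction k with
  | zero =>
    have h : reluCoeff (2 * 0 + 2) ^ 2 ≤ 1 := by
      rw [reluCoeff_add_two, div_pow, mul_pow, inv_pow, Real.sq_sqrt (by positivity),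
        Real.sq_sqrt (by positivity), div_le_one (by positivity)]
      have : (2 * Real.pi)⁻¹ ≤ 1 := inv_le_one_of_one_le₀ (by linarith [Real.pi_gt_three])
      simp [Nat.factorial] at this ⊢
      linarith
    rw [Nat.cast_zero, zero_add, one_pow, mul_one]
    exact pow_le_one₀ (by positivity) h
  | succ k ih =>
    refine le_trans ?_ ih
    have h := reluCoeff_sq_succ k
    rw [← eq_div_iff (by positivity)] at h
    rw [h]
    generalize reluCoeff (2 * k + 2) ^ 2 = a
    rw [div_pow, mul_pow, div_mul_eq_mul_div, div_le_iff₀ (by positivity), mul_assoc,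
      mul_assoc]
    refine mul_le_mul_of_nonneg_left ?_ (sq_nonneg a)
    push_cast
    rw [← sub_nonneg]
    ring_nf
    positivity

lemma sum_reluCoeff_sq_le (D n : ℕ) :
    ∑ m ∈ Finset.range n, (if D < m ∧ Even m then reluCoeff m ^ 2 else 0) ≤
      ((D / 2 : ℕ) + 2) * reluCoeff (2 * (D / 2) + 2) ^ 2 := by
  have hnn (m : ℕ) : 0 ≤ if D < m ∧ Even m then reluCoeff m ^ 2 else 0 := by
    split_ifs <;> positivity
  have main (j : ℕ) :
      ∑ m ∈ Finset.range (2 * (D / 2 + j) + 2),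
          (if D < m ∧ Even m then reluCoeff m ^ 2 else 0) +
        ((D / 2 + j : ℕ) + 2) * reluCoeff (2 * (D / 2 + j) + 2) ^ 2 ≤
      ((D / 2 : ℕ) + 2) * reluCoeff (2 * (D / 2) + 2) ^ 2 := by
    induction j with
    | zero =>
      rw [Finset.sum_eq_zero, zero_add, add_zero]
      intro m hm
      rw [Finset.mem_range] at hm
      rw [if_neg]
      rintro ⟨h, r, rfl⟩
      omega
    | succ j ih =>
      have h := reluCoeff_sq_telescope (D / 2 + j)
      rw [← add_assoc, show 2 * (D / 2 + j + 1) + 2 = 2 * (D / 2 + j) + 2 + 1 + 1 by ring,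
        Finset.sum_range_succ, Finset.sum_range_succ,
        if_pos ⟨by omega, ⟨D / 2 + j + 1, by ring⟩⟩,
        if_neg (by rintro ⟨-, r, hr⟩; omega)]
      rw [show 2 * (D / 2 + j + 1) + 2 = 2 * (D / 2 + j) + 2 + 1 + 1 by ring] at h
      linarith
  exact (Finset.sum_le_sum_of_subset_of_nonneg
    (Finset.range_subset_range.2 (by omega)) fun i _ _ => hnn i).trans
    ((le_add_of_nonneg_right (by positivity)).trans (main n))

/-- The tail sum `Σ_{m > D, m even} c_m²` is `O(D^{-3/2})`. -/
theorem reluCoeff_tail_sum :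
    ∃ K : ℝ, ∀ D : ℕ, 1 ≤ D →
      ∑' m : ℕ, (if D < m ∧ Even m then (reluCoeff m) ^ 2 else 0) ≤
        K * (D : ℝ) ^ (-(3 / 2 : ℝ)) := by
  refine ⟨6, fun D hD => ?_⟩
  refine (Real.tsum_le_of_sum_range_le (fun m => by split_ifs <;> positivity)
    (sum_reluCoeff_sq_le D)).trans ?_
  have hD0 : (0 : ℝ) < D := by exact_mod_cast hD
  have hpow : ((D : ℝ) ^ (-(3 / 2 : ℝ))) ^ 2 = ((D : ℝ) ^ 3)⁻¹ := by
    rw [← Real.rpow_natCast, ← Real.rpow_mul hD0.le, ← Real.rpow_natCast, ← Real.rpow_neg hD0.le]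
    norm_num
  refine (sq_le_sq₀ (by positivity) (by positivity)).1 ?_
  have hk : (D : ℝ) ≤ 2 * ((D / 2 : ℕ) + 1) := by
    norm_cast
    omega
  have h := reluCoeff_sq_sq_mul_le (D / 2)
  have ha := sq_nonneg (reluCoeff (2 * (D / 2) + 2))
  generalize reluCoeff (2 * (D / 2) + 2) ^ 2 = a at h ha
  generalize D / 2 = k at h hk
  rw [mul_pow, mul_pow, hpow, ← div_eq_mul_inv, le_div_iff₀ (by positivity)]
  calc ((k : ℝ) + 2) ^ 2 * a ^ 2 * D ^ 3
      ≤ (2 * (k + 1)) ^ 2 * a ^ 2 * (2 * (k + 1)) ^ 3 := by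
        gcongr
        linarith [k.cast_nonneg (α := ℝ)]
    _ = 32 * (a ^ 2 * (k + 1) ^ 5) := by ring
    _ ≤ 6 ^ 2 := by linarith
end

section
/- For a unit vector v ∈ ℝ^d, X ~ N(0, I_d), and m ∈ ℤ₊, E[ReLU(v·X) H_m(X)] = c_m v^{⊗m}, where c_m = E_{G~N(0,1)}[ReLU(G) h_m(G)] and H_m is the m-th normalized Hermite tensor. -/
open MeasureTheory ProbabilityTheory

/-- The standard Gaussian measure `N(0, I_d)` on `ℝ^d`. -/
noncomputable def stdGaussian (d : ℕ) : Measure (Fin d → ℝ) :=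
  Measure.pi fun _ => gaussianReal 0 1

/-- The entries of the `m`-th normalized Hermite tensor `H_m(x)` on `ℝ^d`:
`(H_m(x))_{i_1,…,i_m} = (1/√(m!)) Σ_{partitions P of [m] into singletons and pairs}`
`⊗_{{a,b} ∈ P} (−I_{i_a,i_b}) ⊗_{{c} ∈ P} x_{i_c}`.  Such partitions are encoded as
involutions `f : Fin m → Fin m` (pairs are the 2-cycles, singletons the fixed points). -/
noncomputable def hermiteTensor (d m : ℕ) (x : Fin d → ℝ) (i : Fin m → Fin d) : ℝ :=
  (Real.sqrt (Nat.factorial m))⁻¹ *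
    ∑ f ∈ Finset.univ.filter (fun f : Fin m → Fin m => ∀ a, f (f a) = a),
      ∏ a, (if f a = a then x (i a)
            else if a < f a then (if i a = i (f a) then (-1 : ℝ) else 0) else 1)

/-- The pairing `⟨H_m(x), v^{⊗m}⟩`. -/
noncomputable def hermitePairing (d m : ℕ) (x v : Fin d → ℝ) : ℝ :=
  ∑ i : Fin m → Fin d, hermiteTensor d m x i * ∏ a, v (i a)

/-- All moments of finite order of `f` under `μ` are finite. -/
def HasAllMoments {α : Type*} [MeasurableSpace α] (μ : Measure α) (f : α → ℝ) : Prop :=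
  ∀ p : ENNReal, p ≠ ⊤ → MemLp f p μ

namespace HasAllMoments

variable {α : Type*} [MeasurableSpace α] {μ : Measure α} {f g : α → ℝ}

theorem mul (hf : HasAllMoments μ f) (hg : HasAllMoments μ g) :
    HasAllMoments μ (fun x => f x * g x) := by
  intro p hp
  have : ENNReal.HolderTriple (2 * p) (2 * p) p := ⟨by
    rw [ENNReal.mul_inv (by simp) (by simp), ← add_mul, ENNReal.inv_two_add_inv_two, one_mul]⟩
  have h2 : 2 * p ≠ ⊤ := ENNReal.mul_ne_top (by simp) hp
  exact (hg _ h2).mul' (hf _ h2)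

theorem const [IsFiniteMeasure μ] (c : ℝ) : HasAllMoments μ (fun _ => c) :=
  fun _ _ => memLp_const c

theorem sum {ι : Type*} {s : Finset ι} {F : ι → α → ℝ} (h : ∀ i ∈ s, HasAllMoments μ (F i)) :
    HasAllMoments μ (fun x => ∑ i ∈ s, F i x) :=
  fun p hp => memLp_finsetSum s fun i hi => h i hi p hp

theorem prod [IsFiniteMeasure μ] {ι : Type*} {s : Finset ι} {F : ι → α → ℝ}
    (h : ∀ i ∈ s, HasAllMoments μ (F i)) : HasAllMoments μ (fun x => ∏ i ∈ s, F i x) := by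
  classical
  induction s using Finset.induction_on with
  | empty => simpa using const 1
  | insert a s ha ih =>
    simp only [Finset.prod_insert ha]
    exact (h a (by simp)).mul (ih fun i hi => h i (by simp [hi]))

theorem integrable (h : HasAllMoments μ f) : Integrable f μ :=
  memLp_one_iff_integrable.1 (h 1 (by simp))

theorem comp_measurePreserving {β : Type*} [MeasurableSpace β] {ν : Measure β} {T : β → α}
    (hf : HasAllMoments μ f) (hT : MeasurePreserving T ν μ) :
    HasAllMoments ν (fun x => f (T x)) :=
  fun p hp => (hf p hp).comp_measurePreserving hT

end HasAllMoments

theorem hasAllMoments_id_gaussianReal : HasAllMoments (gaussianReal 0 1) (fun t : ℝ => t) :=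
  fun p hp => memLp_id_gaussianReal' p hp

theorem hasAllMoments_polynomial_gaussianReal (p : Polynomial ℤ) :
    HasAllMoments (gaussianReal 0 1) (fun t : ℝ => Polynomial.aeval t p) := by
  simp only [Polynomial.aeval_eq_sum_range, zsmul_eq_mul]
  refine HasAllMoments.sum fun k _ => (HasAllMoments.const _).mul ?_
  simpa using HasAllMoments.prod (s := Finset.range k) fun _ _ => hasAllMoments_id_gaussianReal

theorem hasAllMoments_relu_gaussianReal :
    HasAllMoments (gaussianReal 0 1) (fun t : ℝ => max 0 t) := by
  intro p hp
  refine (hasAllMoments_id_gaussianReal p hp).mono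
    (measurable_const.max measurable_id).aestronglyMeasurable (ae_of_all _ fun t => ?_)
  rw [Real.norm_eq_abs, Real.norm_eq_abs, abs_of_nonneg (le_max_left _ _)]
  exact max_le (abs_nonneg t) (le_abs_self t)

instance isProbabilityMeasure_stdGaussian (d : ℕ) :
    IsProbabilityMeasure (_root_.stdGaussian d) := by
  unfold _root_.stdGaussian; infer_instance

theorem hasAllMoments_eval_stdGaussian {d : ℕ} (j : Fin d) :
    HasAllMoments (_root_.stdGaussian d) (fun x => x j) :=
  hasAllMoments_id_gaussianReal.comp_measurePreserving
    (measurePreserving_eval (fun _ : Fin d => gaussianReal 0 1) j)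

/-- A unit-norm linear form of a standard Gaussian vector is standard Gaussian. -/
theorem measurePreserving_linearForm_stdGaussian {d : ℕ} {v : Fin d → ℝ}
    (hv : ∑ j, v j ^ 2 = 1) :
    MeasurePreserving (fun x : Fin d → ℝ => ∑ j, v j * x j) (_root_.stdGaussian d)
      (gaussianReal 0 1) := by
  have hmeas : Measurable fun x : Fin d → ℝ => ∑ j, v j * x j := by fun_prop
  refine ⟨hmeas, Measure.ext_of_charFun ?_⟩
  ext t
  have h1 : ∀ x : Fin d → ℝ, Complex.exp (t * ((∑ j, v j * x j : ℝ) : ℂ) * Complex.I) =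
      ∏ j, Complex.exp ((t * v j : ℝ) * (x j : ℂ) * Complex.I) := fun x => by
    rw [← Complex.exp_sum]
    congr 1
    push_cast
    rw [Finset.mul_sum, Finset.sum_mul]
    exact Finset.sum_congr rfl fun j _ => by ring
  rw [charFun_apply_real, integral_map hmeas.aemeasurable (by fun_prop)]
  simp_rw [h1]
  rw [_root_.stdGaussian, integral_fintype_prod_eq_prod
    (f := fun j (y : ℝ) => Complex.exp ((t * v j : ℝ) * (y : ℂ) * Complex.I))]
  simp_rw [← charFun_apply_real, charFun_gaussianReal, ← Complex.exp_sum]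
  congr 1
  have hv' : ∑ j, (v j : ℂ) ^ 2 = 1 := by exact_mod_cast hv
  simp [mul_pow, ← Finset.sum_div, ← Finset.mul_sum, hv']

theorem stdGaussian_eq_withDensity (d : ℕ) :
    _root_.stdGaussian d = (volume : Measure (Fin d → ℝ)).withDensity
      (fun x => ENNReal.ofReal (∏ j, gaussianPDFReal 0 1 (x j))) := by
  refine Measure.pi_eq fun s hs => ?_
  rw [withDensity_apply _ (MeasurableSet.univ_pi hs), volume_pi, Measure.restrict_pi_pi,
    ← ofReal_integral_eq_lintegral_ofReal
      (Integrable.fintype_prod fun j => (integrable_gaussianPDFReal 0 1).restrict)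
      (ae_of_all _ fun x => Finset.prod_nonneg fun j _ => gaussianPDFReal_nonneg _ _ _),
    integral_fintype_prod_eq_prod,
    ENNReal.ofReal_prod_of_nonneg fun j _ =>
      integral_nonneg fun x => gaussianPDFReal_nonneg _ _ _]
  exact Finset.prod_congr rfl fun j _ => (gaussianReal_apply_eq_integral 0 one_ne_zero _).symm

theorem hasDerivAt_gaussianPDFReal_std (t : ℝ) :
    HasDerivAt (gaussianPDFReal 0 1) (-t * gaussianPDFReal 0 1 t) t := by
  unfold gaussianPDFReal
  have h : HasDerivAt (fun x : ℝ => -(x - 0) ^ 2 / (2 * ((1 : NNReal) : ℝ))) (-t) t := by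
    have := (((hasDerivAt_id t).sub_const 0).pow 2).neg.div_const (2 * ((1 : NNReal) : ℝ))
    convert! this using 1
    simp
    ring
  convert! h.exp.const_mul (Real.sqrt (2 * Real.pi * ((1 : NNReal) : ℝ)))⁻¹ using 1
  ring

theorem hasLineDerivAt_prod_gaussianPDFReal {d : ℕ} (w x : Fin d → ℝ) :
    HasLineDerivAt ℝ (fun x : Fin d → ℝ => ∏ j, gaussianPDFReal 0 1 (x j))
      (-((∑ j, w j * x j) * ∏ j, gaussianPDFReal 0 1 (x j))) x w := by
  unfold HasLineDerivAt
  have h : ∀ j ∈ Finset.univ, HasDerivAt (fun t : ℝ => gaussianPDFReal 0 1 ((x + t • w) j))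
      (-(x j) * gaussianPDFReal 0 1 (x j) * w j) 0 := fun j _ => by
    have h1 : HasDerivAt (fun t : ℝ => (x + t • w) j) (w j) 0 := by
      simpa using ((hasDerivAt_id (0 : ℝ)).mul_const (w j)).const_add (x j)
    have h2 := hasDerivAt_gaussianPDFReal_std ((x + (0 : ℝ) • w) j)
    simpa [Function.comp_def] using HasDerivAt.comp (0 : ℝ) h2 h1
  convert! HasDerivAt.fun_finsetProd h using 1
  simp only [zero_smul, add_zero, smul_eq_mul]
  rw [Finset.sum_mul, ← Finset.sum_neg_distrib]
  refine Finset.sum_congr rfl fun j _ => ?_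
  rw [← Finset.mul_prod_erase _ _ (Finset.mem_univ j)]
  ring

/-- Gaussian integration by parts in the direction `w`. -/
theorem integral_linearForm_mul_stdGaussian {d : ℕ} {w : Fin d → ℝ} {F F' : (Fin d → ℝ) → ℝ}
    (hF : HasAllMoments (_root_.stdGaussian d) F) (hF' : HasAllMoments (_root_.stdGaussian d) F')
    (hd : ∀ x, HasLineDerivAt ℝ F (F' x) x w) :
    ∫ x, (∑ j, w j * x j) * F x ∂(_root_.stdGaussian d) = ∫ x, F' x ∂(_root_.stdGaussian d) := by
  set ρ : (Fin d → ℝ) → ℝ := fun x => ∏ j, gaussianPDFReal 0 1 (x j) with hρ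
  have hρ0 : ∀ x, 0 ≤ ρ x := fun x => Finset.prod_nonneg fun j _ => gaussianPDFReal_nonneg _ _ _
  have hρm : Measurable ρ := by
    refine Finset.measurable_fun_prod _ fun j _ => ?_
    exact (measurable_gaussianPDFReal 0 1).comp (measurable_pi_apply j)
  have hwF : HasAllMoments (_root_.stdGaussian d) fun x => (∑ j, w j * x j) * F x :=
    (HasAllMoments.sum fun j _ => (HasAllMoments.const (w j)).mul
      (hasAllMoments_eval_stdGaussian j)).mul hF
  have key : ∀ G : (Fin d → ℝ) → ℝ, HasAllMoments (_root_.stdGaussian d) G →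
      Integrable (fun x => G x * ρ x) ∧
        ∫ x, G x ∂(_root_.stdGaussian d) = ∫ x, G x * ρ x := by
    intro G hG
    have hG := hG.integrable
    rw [stdGaussian_eq_withDensity] at hG ⊢
    rw [integrable_withDensity_iff_integrable_smul' hρm.ennreal_ofReal (by simp)] at hG
    rw [integral_withDensity_eq_integral_toReal_smul hρm.ennreal_ofReal (by simp)]
    simp only [ENNReal.toReal_ofReal (hρ0 _), smul_eq_mul, mul_comm (ρ _)] at hG ⊢
    exact ⟨hG, trivial⟩
  have hibp := integral_bilinear_hasLineDerivAt_right_eq_neg_left_of_integrable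
    (μ := (volume : Measure (Fin d → ℝ))) (B := ContinuousLinearMap.mul ℝ ℝ)
    (f := F) (f' := F') (g := ρ) (g' := fun x => -((∑ j, w j * x j) * ρ x)) (v := w)
    (by simpa using (key F' hF').1)
    (by
      convert! (key _ hwF).1.neg using 2 with x
      simp only [ContinuousLinearMap.mul_apply', Pi.neg_apply]
      ring)
    (by simpa using (key F hF).1) (fun x _ => hd x)
    (fun x _ => hasLineDerivAt_prod_gaussianPDFReal w x)
  rw [(key _ hwF).2, (key _ hF').2]
  simp only [ContinuousLinearMap.mul_apply', mul_neg, integral_neg, neg_inj] at hibp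
  rw [← hibp]
  exact integral_congr_ae (ae_of_all _ fun x => by ring)

/-- The factor contributed by the index `a` to the term of the involution `f`. -/
noncomputable def hermiteFactor {d m : ℕ} (i : Fin m → Fin d) (f : Fin m → Fin m)
    (x : Fin d → ℝ) (a : Fin m) : ℝ :=
  if f a = a then x (i a)
  else if a < f a then (if i a = i (f a) then (-1 : ℝ) else 0) else 1

/-- The involutions of `Fin m` that fix every point outside `S`. -/
def involutionsOn {m : ℕ} (S : Finset (Fin m)) : Finset (Fin m → Fin m) :=
  Finset.univ.filter fun f => (∀ a, f (f a) = a) ∧ ∀ a ∉ S, f a = a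

/-- The unnormalized Hermite tensor entry on the indices in `S`. -/
noncomputable def partialHermite {d m : ℕ} (i : Fin m → Fin d) (S : Finset (Fin m))
    (x : Fin d → ℝ) : ℝ :=
  ∑ f ∈ involutionsOn S, ∏ a ∈ S, hermiteFactor i f x a

theorem mem_involutionsOn {m : ℕ} {S : Finset (Fin m)} {f : Fin m → Fin m} :
    f ∈ involutionsOn S ↔ (∀ a, f (f a) = a) ∧ ∀ a ∉ S, f a = a := by
  simp [involutionsOn]

theorem filter_fixed_involutionsOn {m : ℕ} (S : Finset (Fin m)) (a : Fin m) :
    (involutionsOn S).filter (fun f => f a = a) = involutionsOn (S.erase a) := by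
  ext f
  simp only [Finset.mem_filter, mem_involutionsOn, Finset.mem_erase]
  grind

theorem partialHermite_empty {d m : ℕ} (i : Fin m → Fin d) (x : Fin d → ℝ) :
    partialHermite i ∅ x = 1 := by
  have : involutionsOn (∅ : Finset (Fin m)) = {id} := by
    ext f
    simp only [mem_involutionsOn, Finset.mem_singleton, funext_iff, id]
    grind
  simp [partialHermite, this]

/-- The terms of the involutions exchanging `a` and `b`. -/
theorem sum_involutionsOn_pair {d m : ℕ} (i : Fin m → Fin d) {S : Finset (Fin m)} {a b : Fin m}
    (ha : a ∉ S) (hb : b ∈ S) (x : Fin d → ℝ) :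
    ∑ f ∈ (involutionsOn (insert a S)).filter (fun f => f a = b),
        ∏ c ∈ insert a S, hermiteFactor i f x c =
      (if i a = i b then (-1 : ℝ) else 0) * partialHermite i (S.erase b) x := by
  have hab : a ≠ b := fun h => ha (h ▸ hb)
  rw [partialHermite, Finset.mul_sum]
  refine Finset.sum_nbij' (fun f => Equiv.swap a b ∘ f) (fun f => Equiv.swap a b ∘ f) ?_ ?_ ?_ ?_ ?_
  · intro f hf
    simp only [Finset.mem_filter, mem_involutionsOn, Finset.mem_erase, Finset.mem_insert,
      Function.comp_apply, Equiv.swap_apply_def] at hf ⊢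
    grind
  · intro f hf
    simp only [Finset.mem_filter, mem_involutionsOn, Finset.mem_erase, Finset.mem_insert,
      Function.comp_apply, Equiv.swap_apply_def] at hf ⊢
    grind
  · intro f _
    ext c
    simp
  · intro f _
    ext c
    simp
  · intro f hf
    obtain ⟨⟨hinv, -⟩, hfa⟩ : ((∀ c, f (f c) = c) ∧ _) ∧ f a = b := by
      simpa [mem_involutionsOn] using hf
    have hfb : f b = a := by rw [← hfa, hinv]
    rw [Finset.prod_insert ha, ← Finset.mul_prod_erase S _ hb, ← mul_assoc]
    congr 1
    · simp only [hermiteFactor, hfa, hfb, hab, hab.symm, if_false]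
      rcases lt_or_gt_of_ne hab with h | h
      · simp [h, h.not_gt]
      · simp [h, h.not_gt, eq_comm]
    · refine Finset.prod_congr rfl fun c hc => ?_
      have hc' : c ≠ b ∧ c ≠ a :=
        ⟨(Finset.mem_erase.1 hc).1, fun h => ha (h ▸ (Finset.mem_erase.1 hc).2)⟩
      have : Equiv.swap a b (f c) = f c := by
        refine Equiv.swap_apply_of_ne_of_ne (fun h => hc'.1 ?_) (fun h => hc'.2 ?_)
        · rw [← hinv c, h, hfa]
        · rw [← hinv c, h, hfb]
      simp [hermiteFactor, this]

/-- The recursion of the Hermite tensor entries. -/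
theorem partialHermite_insert {d m : ℕ} (i : Fin m → Fin d) {S : Finset (Fin m)} {a : Fin m}
    (ha : a ∉ S) (x : Fin d → ℝ) :
    partialHermite i (insert a S) x = x (i a) * partialHermite i S x +
      ∑ b ∈ S, (if i a = i b then (-1 : ℝ) else 0) * partialHermite i (S.erase b) x := by
  have hmap : ∀ f ∈ involutionsOn (insert a S), f a ∈ insert a S := by
    intro f hf
    rw [mem_involutionsOn] at hf
    by_contra h
    have h1 := hf.2 _ h
    rw [hf.1] at h1
    exact h (h1 ▸ Finset.mem_insert_self a S)
  rw [partialHermite, ← Finset.sum_fiberwise_of_maps_to hmap, Finset.sum_insert ha]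
  congr 1
  · rw [filter_fixed_involutionsOn, Finset.erase_insert ha, partialHermite, Finset.mul_sum]
    refine Finset.sum_congr rfl fun f hf => ?_
    rw [Finset.prod_insert ha, hermiteFactor, if_pos ((mem_involutionsOn.1 hf).2 a ha)]
  · exact Finset.sum_congr rfl fun b hb => sum_involutionsOn_pair i ha hb x

theorem hasLineDerivAt_partialHermite {d m : ℕ} (i : Fin m → Fin d) (S : Finset (Fin m))
    (w x : Fin d → ℝ) :
    HasLineDerivAt ℝ (partialHermite i S)
      (∑ a ∈ S, w (i a) * partialHermite i (S.erase a) x) x w := by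
  have hfac : ∀ (f : Fin m → Fin m) (a : Fin m),
      HasDerivAt (fun t : ℝ => hermiteFactor i f (x + t • w) a)
        (if f a = a then w (i a) else 0) 0 := by
    intro f a
    by_cases h : f a = a
    · simpa [hermiteFactor, h] using
        ((hasDerivAt_id (0 : ℝ)).mul_const (w (i a))).const_add (x (i a))
    · simp only [hermiteFactor, h, if_false]
      exact hasDerivAt_const _ _
  have hsum := HasDerivAt.fun_sum (u := involutionsOn S) fun f _ =>
    HasDerivAt.fun_finsetProd (u := S) fun a _ => hfac f a
  unfold HasLineDerivAt partialHermite
  convert! hsum using 1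
  rw [Finset.sum_comm]
  refine Finset.sum_congr rfl fun a _ => ?_
  simp only [zero_smul, add_zero, smul_eq_mul, mul_ite, mul_zero]
  rw [← Finset.sum_filter, filter_fixed_involutionsOn, Finset.mul_sum]
  exact Finset.sum_congr rfl fun f _ => mul_comm _ _

theorem hasAllMoments_partialHermite {d m : ℕ} (i : Fin m → Fin d) (S : Finset (Fin m)) :
    HasAllMoments (_root_.stdGaussian d) (partialHermite i S) := by
  refine HasAllMoments.sum fun f _ => HasAllMoments.prod fun a _ => ?_
  unfold hermiteFactor
  split_ifs
  exacts [hasAllMoments_eval_stdGaussian _, .const _, .const _, .const _]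

theorem derivative_hermite_succ (n : ℕ) :
    Polynomial.derivative (Polynomial.hermite (n + 1)) =
      ((n + 1 : ℕ) : Polynomial ℤ) * Polynomial.hermite n := by
  induction n with
  | zero => simp
  | succ n ih =>
    rw [Polynomial.hermite_succ (n + 1), Polynomial.derivative_sub, Polynomial.derivative_mul,
      Polynomial.derivative_X, ih, Polynomial.derivative_mul, Polynomial.derivative_natCast,
      Polynomial.hermite_succ n]
    push_cast
    ring

theorem aeval_hermite_succ (n : ℕ) (t : ℝ) :
    Polynomial.aeval t (Polynomial.hermite (n + 1)) =
      t * Polynomial.aeval t (Polynomial.hermite n) -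
        n * Polynomial.aeval t (Polynomial.hermite (n - 1)) := by
  rw [Polynomial.hermite_succ]
  cases n with
  | zero => simp
  | succ n => rw [derivative_hermite_succ]; simp

/-- The moment of a function of `v · X` against a Hermite tensor entry. -/
theorem integral_ridge_mul_partialHermite {d m : ℕ} {v : Fin d → ℝ} (hv : ∑ j, v j ^ 2 = 1)
    (i : Fin m → Fin d) (S : Finset (Fin m)) (φ : ℝ → ℝ)
    (hφ : HasAllMoments (gaussianReal 0 1) φ) :
    ∫ x, φ (∑ j, v j * x j) * partialHermite i S x ∂(_root_.stdGaussian d) =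
      (∏ a ∈ S, v (i a)) *
        ∫ t, φ t * Polynomial.aeval t (Polynomial.hermite S.card) ∂(gaussianReal 0 1) := by
  induction hn : S.card using Nat.strong_induction_on generalizing S φ with
  | _ n ih =>
  have hT := measurePreserving_linearForm_stdGaussian hv
  rcases S.eq_empty_or_nonempty with rfl | ⟨a, ha⟩
  · obtain rfl : n = 0 := by simpa using hn.symm
    simp only [partialHermite_empty, mul_one, Finset.prod_empty, one_mul,
      Polynomial.hermite_zero, map_one]
    rw [← hT.map_eq, integral_map hT.measurable.aemeasurable]
    rw [hT.map_eq]
    exact hφ.integrable.aestronglyMeasurable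
  obtain ⟨S, haS, rfl⟩ : ∃ T, a ∉ T ∧ insert a T = S :=
    ⟨S.erase a, Finset.notMem_erase a S, Finset.insert_erase ha⟩
  rw [Finset.card_insert_of_notMem haS] at hn
  subst hn
  have hφT := hφ.comp_measurePreserving hT
  have hlin := hasAllMoments_id_gaussianReal.mul hφ
  set w : Fin d → ℝ := fun j => (if i a = j then 1 else 0) - v (i a) * v j with hw
  have hwx : ∀ x : Fin d → ℝ, ∑ j, w j * x j = x (i a) - v (i a) * ∑ j, v j * x j := by
    intro x
    simp [hw, sub_mul, Finset.mul_sum, mul_assoc]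
  have hwv : ∑ j, v j * w j = 0 := by
    have := hwx v
    simp only [← sq, hv] at this
    simpa [mul_comm] using this
  -- `φ (v · x)` is constant in the direction `w`, which is orthogonal to `v`.
  have hd : ∀ x, HasLineDerivAt ℝ (fun x => φ (∑ j, v j * x j) * partialHermite i S x)
      (φ (∑ j, v j * x j) * ∑ b ∈ S, w (i b) * partialHermite i (S.erase b) x) x w := by
    intro x
    have hconst : ∀ t : ℝ, ∑ j, v j * (x + t • w) j = ∑ j, v j * x j := by
      intro t
      have : ∑ j, v j * (x + t • w) j = ∑ j, v j * x j + t * ∑ j, v j * w j := by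
        rw [Finset.mul_sum, ← Finset.sum_add_distrib]
        exact Finset.sum_congr rfl fun j _ => by simp; ring
      rw [this, hwv, mul_zero, add_zero]
    unfold HasLineDerivAt
    simp only [hconst]
    exact HasDerivAt.const_mul _ (hasLineDerivAt_partialHermite i S w x)
  have hP := fun b : Fin m => hφT.mul (hasAllMoments_partialHermite i (S.erase b))
  have hibp := integral_linearForm_mul_stdGaussian
    (hφT.mul (hasAllMoments_partialHermite i S))
    (hφT.mul (HasAllMoments.sum fun b _ => (HasAllMoments.const (w (i b))).mul
      (hasAllMoments_partialHermite i (S.erase b)))) hd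
  have hexp : ∀ x : Fin d → ℝ, φ (∑ j, v j * x j) * partialHermite i (insert a S) x =
      v (i a) * (((∑ j, v j * x j) * φ (∑ j, v j * x j)) * partialHermite i S x) +
      ((∑ j, w j * x j) * (φ (∑ j, v j * x j) * partialHermite i S x) +
      ∑ b ∈ S, (if i a = i b then (-1 : ℝ) else 0) *
        (φ (∑ j, v j * x j) * partialHermite i (S.erase b) x)) := by
    intro x
    rw [partialHermite_insert i haS, hwx, mul_add, Finset.mul_sum]
    have : ∀ b, (if i a = i b then (-1 : ℝ) else 0) *
        (φ (∑ j, v j * x j) * partialHermite i (S.erase b) x) =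
        φ (∑ j, v j * x j) * ((if i a = i b then (-1 : ℝ) else 0) *
          partialHermite i (S.erase b) x) := fun b => by ring
    simp only [this]
    ring
  have hwform : HasAllMoments (_root_.stdGaussian d) fun x => ∑ j, w j * x j :=
    HasAllMoments.sum fun j _ => (HasAllMoments.const (w j)).mul (hasAllMoments_eval_stdGaussian j)
  have hint1 := ((HasAllMoments.const (v (i a))).mul
    ((hlin.comp_measurePreserving hT).mul (hasAllMoments_partialHermite i S))).integrable
  have hint2 := (hwform.mul (hφT.mul (hasAllMoments_partialHermite i S))).integrable
  have hint3 := fun b : Fin m =>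
    ((HasAllMoments.const (if i a = i b then (-1 : ℝ) else 0)).mul (hP b)).integrable
  have hint4 := fun b : Fin m => ((HasAllMoments.const (w (i b))).mul (hP b)).integrable
  have hsplit : ∀ x : Fin d → ℝ,
      φ (∑ j, v j * x j) * ∑ b ∈ S, w (i b) * partialHermite i (S.erase b) x =
      ∑ b ∈ S, w (i b) * (φ (∑ j, v j * x j) * partialHermite i (S.erase b) x) := fun x => by
    rw [Finset.mul_sum]
    exact Finset.sum_congr rfl fun b _ => by ring
  simp only [hexp]
  rw [integral_add hint1 (hint2.fun_add (integrable_finsetSum S fun b _ => hint3 b)),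
    integral_add hint2 (integrable_finsetSum S fun b _ => hint3 b), hibp]
  simp only [hsplit]
  rw [integral_finsetSum S fun b _ => hint3 b, integral_finsetSum S fun b _ => hint4 b,
    ← Finset.sum_add_distrib, integral_const_mul,
    ih S.card (Nat.lt_succ_self _) S (fun t => t * φ t) hlin rfl]
  have hterm : ∀ b ∈ S,
      ∫ x, w (i b) * (φ (∑ j, v j * x j) * partialHermite i (S.erase b) x)
          ∂(_root_.stdGaussian d) +
        ∫ x, (if i a = i b then (-1 : ℝ) else 0) *
          (φ (∑ j, v j * x j) * partialHermite i (S.erase b) x) ∂(_root_.stdGaussian d) =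
      -(v (i a) * ∏ c ∈ S, v (i c)) *
        ∫ t, φ t * Polynomial.aeval t (Polynomial.hermite (S.card - 1)) ∂(gaussianReal 0 1) := by
    intro b hb
    have hcard : (S.erase b).card = S.card - 1 := Finset.card_erase_of_mem hb
    rw [integral_const_mul, integral_const_mul,
      ih (S.card - 1) (by omega) (S.erase b) φ hφ hcard, ← Finset.mul_prod_erase S _ hb]
    simp only [hw]
    split_ifs <;> ring
  have hG1 := (hlin.mul (hasAllMoments_polynomial_gaussianReal
    (Polynomial.hermite S.card))).integrable
  have hG2 := ((HasAllMoments.const (S.card : ℝ)).mul (hφ.mul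
    (hasAllMoments_polynomial_gaussianReal (Polynomial.hermite (S.card - 1))))).integrable
  have hrec : ∀ t : ℝ, φ t * Polynomial.aeval t (Polynomial.hermite (S.card + 1)) =
      t * φ t * Polynomial.aeval t (Polynomial.hermite S.card) -
        S.card * (φ t * Polynomial.aeval t (Polynomial.hermite (S.card - 1))) := fun t => by
    rw [aeval_hermite_succ]
    ring
  simp only [hrec]
  rw [Finset.sum_congr rfl hterm, Finset.sum_const, nsmul_eq_mul, Finset.prod_insert haS,
    integral_sub hG1 hG2, integral_const_mul]
  ring

theorem hermiteTensor_eq_partialHermite {d m : ℕ} (x : Fin d → ℝ) (i : Fin m → Fin d) :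
    hermiteTensor d m x i =
      (Real.sqrt (Nat.factorial m))⁻¹ * partialHermite i Finset.univ x := by
  simp [hermiteTensor, partialHermite, involutionsOn, hermiteFactor]

/-- For a unit vector `v ∈ ℝ^d`, `X ~ N(0, I_d)` and `m ∈ ℤ₊`,
`E[ReLU(v·X) H_m(X)] = c_m v^{⊗m}` (stated entrywise). -/
theorem relu_hermite_tensor_moment (d m : ℕ) (hm : 0 < m)
    (v : Fin d → ℝ) (hv : ∑ j, v j ^ 2 = 1) (i : Fin m → Fin d) :
    ∫ x, max 0 (∑ j, v j * x j) * hermiteTensor d m x i ∂(stdGaussian d) =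
      reluCoeff m * ∏ a, v (i a) := by
  have h := integral_ridge_mul_partialHermite hv i Finset.univ _ hasAllMoments_relu_gaussianReal
  simp only [hermiteTensor_eq_partialHermite, reluCoeff, hermiteN, div_eq_inv_mul,
    mul_left_comm _ (Real.sqrt (Nat.factorial m))⁻¹]
  rw [integral_const_mul, integral_const_mul, h, Finset.card_univ, Fintype.card_fin]
  ring
end

section
/- Even-order tensor moment comparison: let V be a finite-dimensional inner product space, w_1,…,w_k ∈ ℝ, v_1,…,v_k ∈ V with ‖v_i‖ ≤ 1, and M_t = Σ_{i=1}^k w_i v_i^{⊗t}. Then for every even t ≥ 2k, ‖M_t‖_2 ≤ binom(t, k−1)·(2k)^k · max{‖M_s‖_2 : s < 2k, s even}. -/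
open RealInnerProductSpace

/-- The norm `‖M_t‖₂ = ‖Σ_i w_i v_i^{⊗t}‖₂` of the `t`-th moment tensor in `V^{⊗t}`, where
`V^{⊗t}` carries the inner product induced by that of `V` (so that
`⟨v^{⊗t}, u^{⊗t}⟩ = ⟨v,u⟩^t`); by expanding, `‖M_t‖₂² = Σ_{i,j} w_i w_j ⟨v_i, v_j⟩^t`. -/
noncomputable def momentTensorNorm {V : Type*} [NormedAddCommGroup V]
    [InnerProductSpace ℝ V] (k : ℕ) (w : Fin k → ℝ) (v : Fin k → V) (t : ℕ) : ℝ :=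
  Real.sqrt (∑ i, ∑ j, w i * w j * ⟪v i, v j⟫ ^ t)
open scoped TensorProduct

open scoped MatrixOrder Matrix.Norms.L2Operator in
open Matrix in
theorem Matrix.PosSemidef.exists_eq_gram {n : Type*} [Fintype n] [DecidableEq n]
    {C : Matrix n n ℝ} (hC : C.PosSemidef) : ∃ d : n → EuclideanSpace ℝ n, C = gram ℝ d := by
  obtain ⟨B, rfl⟩ : ∃ B : Matrix n n ℝ, C = Bᴴ * B := by
    obtain ⟨B, hB⟩ := CStarAlgebra.nonneg_iff_eq_star_mul_self.mp hC.nonneg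
    exact ⟨B, hB⟩
  refine ⟨fun i => WithLp.toLp 2 (fun l => B l i), ?_⟩
  ext i j
  simp [gram_apply, Matrix.mul_apply, PiLp.inner_apply, mul_comm]

/-- The norm `‖∑ i, d i‖` of the sum of any family of vectors `d` with Gram matrix `C`. -/
noncomputable def Matrix.sumNorm {n : Type*} [Fintype n] (C : Matrix n n ℝ) : ℝ :=
  √(∑ i, ∑ j, C i j)

open Matrix

theorem Matrix.sumNorm_gram {n E : Type*} [Fintype n] [NormedAddCommGroup E]
    [InnerProductSpace ℝ E] (d : n → E) : (gram ℝ d).sumNorm = ‖∑ i, d i‖ := by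
  rw [norm_eq_sqrt_real_inner, sumNorm]
  simp only [gram_apply, sum_inner, inner_sum, real_inner_comm]

theorem Matrix.gram_hadamard_gram {n E F : Type*} [NormedAddCommGroup E]
    [InnerProductSpace ℝ E] [NormedAddCommGroup F] [InnerProductSpace ℝ F]
    (d : n → E) (x : n → F) :
    gram ℝ d ⊙ gram ℝ x =
      @gram (E ⊗[ℝ] F) n ℝ InnerProductSpace.toInner (fun i => d i ⊗ₜ[ℝ] x i) := by
  ext i j
  exact (TensorProduct.inner_tmul ℝ (d i) (d j) (x i) (x j)).symm

theorem Matrix.PosSemidef.sumNorm_hadamard_gram_add_le {n F : Type*} [Fintype n] [DecidableEq n]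
    [NormedAddCommGroup F] [InnerProductSpace ℝ F] {D : Matrix n n ℝ} (hD : D.PosSemidef)
    (x y : n → F) :
    (D ⊙ gram ℝ (x + y)).sumNorm ≤ (D ⊙ gram ℝ x).sumNorm + (D ⊙ gram ℝ y).sumNorm := by
  obtain ⟨d, rfl⟩ := hD.exists_eq_gram
  simp only [gram_hadamard_gram, sumNorm_gram, Pi.add_apply, TensorProduct.tmul_add,
    Finset.sum_add_distrib]
  exact norm_add_le _ _

theorem Matrix.PosSemidef.sumNorm_hadamard_gram_const {n F : Type*} [Fintype n] [DecidableEq n]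
    [NormedAddCommGroup F] [InnerProductSpace ℝ F] {D : Matrix n n ℝ} (hD : D.PosSemidef)
    (x : F) : (D ⊙ gram ℝ (fun _ => x)).sumNorm = ‖x‖ * D.sumNorm := by
  obtain ⟨d, rfl⟩ := hD.exists_eq_gram
  simp only [gram_hadamard_gram, sumNorm_gram, ← TensorProduct.sum_tmul,
    TensorProduct.norm_tmul, mul_comm]

/-- The norm `‖∑ i, c i ⊗ u i ^ ⊗t‖` for any family of vectors `c` with Gram matrix `C`. -/
noncomputable def Matrix.weightedMomentNorm {n F : Type*} [Fintype n] [NormedAddCommGroup F]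
    [InnerProductSpace ℝ F] (C : Matrix n n ℝ) (u : n → F) (t : ℕ) : ℝ :=
  (C ⊙ (gram ℝ u).map (· ^ t)).sumNorm

theorem sum_choose_mul_two_pow_succ (p m : ℕ) :
    ∑ r ∈ Finset.range (p + 1), ((m + 1).choose r : ℝ) * 2 ^ r =
      ∑ r ∈ Finset.range (p + 1), (m.choose r : ℝ) * 2 ^ r +
        2 * ∑ r ∈ Finset.range p, (m.choose r : ℝ) * 2 ^ r := by
  rw [Finset.sum_range_succ', Finset.sum_range_succ' (fun r => (m.choose r : ℝ) * 2 ^ r),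
    Finset.mul_sum, add_right_comm, ← Finset.sum_add_distrib]
  simp only [Nat.choose_succ_succ, Nat.choose_zero_right]
  congr 1
  refine Finset.sum_congr rfl fun r _ => ?_
  push_cast
  ring

section WeightedMoment

variable {n F : Type*} [NormedAddCommGroup F] [InnerProductSpace ℝ F]

theorem hadamard_gram_map_pow_succ (C : Matrix n n ℝ) (u : n → F) (t : ℕ) :
    C ⊙ (gram ℝ u).map (· ^ (t + 1)) = (C ⊙ (gram ℝ u).map (· ^ t)) ⊙ gram ℝ u := by
  ext i j
  simp [pow_succ, mul_assoc]

variable [Fintype n]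

theorem weightedMomentNorm_hadamard (C : Matrix n n ℝ) (x u : n → F) (t : ℕ) :
    (C ⊙ gram ℝ x).weightedMomentNorm u t
      = ((C ⊙ (gram ℝ u).map (· ^ t)) ⊙ gram ℝ x).sumNorm := by
  rw [weightedMomentNorm, hadamard_assoc, hadamard_assoc, hadamard_comm (gram ℝ x)]

theorem Matrix.PosSemidef.hadamard_gram_map_pow {C : Matrix n n ℝ} (hC : C.PosSemidef)
    (u : n → F) (t : ℕ) : (C ⊙ (gram ℝ u).map (· ^ t)).PosSemidef := by
  induction t with
  | zero =>
    convert hC using 1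
    ext i j
    simp
  | succ t ih =>
    rw [hadamard_gram_map_pow_succ]
    exact ih.hadamard (posSemidef_gram ℝ u)

variable [DecidableEq n]

theorem weightedMomentNorm_succ_le {C : Matrix n n ℝ} (hC : C.PosSemidef) (u : n → F)
    {x : F} (hx : ‖x‖ ≤ 1) (t : ℕ) :
    C.weightedMomentNorm u (t + 1) ≤
      C.weightedMomentNorm u t + (C ⊙ gram ℝ (fun i => u i - x)).weightedMomentNorm u t := by
  have hD := hC.hadamard_gram_map_pow u t
  have h := hD.sumNorm_hadamard_gram_add_le (fun _ => x) (fun i => u i - x)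
  rw [hD.sumNorm_hadamard_gram_const, show (fun _ => x) + (fun i => u i - x) = u by ext; simp] at h
  rw [weightedMomentNorm_hadamard]
  rw [weightedMomentNorm, hadamard_gram_map_pow_succ]
  refine h.trans (add_le_add_left ?_ _)
  exact mul_le_of_le_one_left (Real.sqrt_nonneg _) hx

theorem weightedMomentNorm_hadamard_sub_le {C : Matrix n n ℝ} (hC : C.PosSemidef) (u : n → F)
    {x : F} (hx : ‖x‖ ≤ 1) (t : ℕ) :
    (C ⊙ gram ℝ (fun i => u i - x)).weightedMomentNorm u t ≤
      C.weightedMomentNorm u (t + 1) + C.weightedMomentNorm u t := by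
  have hD := hC.hadamard_gram_map_pow u t
  have h := hD.sumNorm_hadamard_gram_add_le u (fun _ => -x)
  rw [hD.sumNorm_hadamard_gram_const, norm_neg,
    show u + (fun _ => -x) = fun i => u i - x by ext; simp [sub_eq_add_neg]] at h
  rw [weightedMomentNorm_hadamard]
  rw [weightedMomentNorm, hadamard_gram_map_pow_succ]
  refine h.trans (add_le_add_right ?_ _)
  exact mul_le_of_le_one_left (Real.sqrt_nonneg _) hx

/-- General tensor moment comparison: the first `p` moments of a weighted family supported on `p`
points of the unit ball control all its moments. -/
theorem weightedMomentNorm_le {u : n → F} (hu : ∀ i, ‖u i‖ ≤ 1) (S : Finset n)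
    {C : Matrix n n ℝ} (hC : C.PosSemidef) (hS : ∀ i j, i ∉ S → C i j = 0) {B : ℝ}
    (hB : ∀ s < S.card, C.weightedMomentNorm u s ≤ B) (m : ℕ) :
    C.weightedMomentNorm u m ≤ (∑ r ∈ Finset.range S.card, (m.choose r : ℝ) * 2 ^ r) * B := by
  induction S using Finset.induction_on generalizing C B m with
  | empty =>
    have : C = 0 := by
      ext i j
      exact hS i j (Finset.notMem_empty i)
    simp [this, weightedMomentNorm, sumNorm]
  | insert a S ha ih =>
    rw [Finset.card_insert_of_notMem ha] at hB ⊢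
    have key := fun m => ih (hC.hadamard (posSemidef_gram ℝ fun i => u i - u a)) (B := 2 * B)
      (fun i j hi => by
        by_cases hia : i = a
        · simp [hia, gram_apply]
        · simp [hS i j (by simp [hi, hia])])
      (fun s hs => by
        have := weightedMomentNorm_hadamard_sub_le hC u (hu a) s
        linarith [hB s (by omega), hB (s + 1) (by omega)]) m
    induction m with
    | zero => simpa [Finset.sum_range_succ'] using hB 0 (by omega)
    | succ m ihm =>
      rw [sum_choose_mul_two_pow_succ]
      linarith [weightedMomentNorm_succ_le hC u (hu a) m, key m]

end WeightedMoment

theorem Nat.choose_le_choose_of_le_half {t r s : ℕ} (hrs : r ≤ s) (hs : s ≤ t / 2) :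
    t.choose r ≤ t.choose s := by
  induction s, hrs using Nat.le_induction with
  | base => exact le_rfl
  | succ s _ ih => exact (ih (by omega)).trans (Nat.choose_le_succ_of_lt_half_left (by omega))

theorem sum_choose_mul_two_pow_le {k m t : ℕ} (hk : 0 < k) (hm : m ≤ t) (ht : 2 * k ≤ t) :
    ∑ r ∈ Finset.range k, (m.choose r : ℝ) * 2 ^ r ≤ (t.choose (k - 1) : ℝ) * (2 * k : ℝ) ^ k := by
  calc ∑ r ∈ Finset.range k, (m.choose r : ℝ) * 2 ^ r
      ≤ ∑ r ∈ Finset.range k, (t.choose (k - 1) : ℝ) * 2 ^ r := by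
        refine Finset.sum_le_sum fun r hr => ?_
        have hr := Finset.mem_range.mp hr
        gcongr
        exact (Nat.choose_le_choose r hm).trans
          (Nat.choose_le_choose_of_le_half (by omega) (by omega))
    _ = (t.choose (k - 1) : ℝ) * (2 ^ k - 1) := by
        rw [← Finset.mul_sum, geom_sum_eq (by norm_num)]
        norm_num
    _ ≤ (t.choose (k - 1) : ℝ) * (2 * k : ℝ) ^ k := by
        have hk1 : (1 : ℝ) ≤ k := by exact_mod_cast hk
        have : (2 : ℝ) ^ k ≤ (2 * k : ℝ) ^ k := by
          gcongr
          linarith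
        gcongr
        linarith

theorem momentTensorNorm_two_mul {V : Type*} [NormedAddCommGroup V] [InnerProductSpace ℝ V]
    (k : ℕ) (w : Fin k → ℝ) (v : Fin k → V) (m : ℕ) :
    momentTensorNorm k w v (2 * m) =
      (gram ℝ w).weightedMomentNorm (fun i => v i ⊗ₜ[ℝ] v i) m := by
  simp only [momentTensorNorm, weightedMomentNorm, sumNorm, hadamard_apply, gram_apply,
    Matrix.map_apply, TensorProduct.inner_tmul, pow_mul, sq]
  simp [mul_comm]

/-- Even-order tensor moment comparison: for even `t ≥ 2k`,
`‖M_t‖₂ ≤ binom(t, k−1)·(2k)^k · max{‖M_s‖₂ : s < 2k, s even}`. -/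
theorem tensor_moment_comparison_even {V : Type*} [NormedAddCommGroup V]
    [InnerProductSpace ℝ V] [FiniteDimensional ℝ V] (k : ℕ) (hk : 0 < k)
    (w : Fin k → ℝ) (v : Fin k → V) (hv : ∀ i, ‖v i‖ ≤ 1)
    (t : ℕ) (ht : 2 * k ≤ t) (hteven : Even t) :
    momentTensorNorm k w v t ≤
      (Nat.choose t (k - 1) : ℝ) * (2 * k : ℝ) ^ k *
        ((Finset.range (2 * k)).filter (fun s => Even s)).sup'
          ⟨0, Finset.mem_filter.mpr ⟨Finset.mem_range.mpr (by omega), even_zero⟩⟩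
          (fun s => momentTensorNorm k w v s) := by
  obtain ⟨m, rfl⟩ := hteven.two_dvd
  have hu : ∀ i, ‖v i ⊗ₜ[ℝ] v i‖ ≤ 1 := fun i => by
    rw [TensorProduct.norm_tmul]
    exact mul_le_one₀ (hv i) (norm_nonneg _) (hv i)
  set B := ((Finset.range (2 * k)).filter (fun s => Even s)).sup'
    ⟨0, Finset.mem_filter.mpr ⟨Finset.mem_range.mpr (by omega), even_zero⟩⟩
    (fun s => momentTensorNorm k w v s) with hB
  have hle : ∀ s < k, momentTensorNorm k w v (2 * s) ≤ B := fun s hs =>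
    Finset.le_sup' (fun s => momentTensorNorm k w v s)
      (Finset.mem_filter.mpr ⟨Finset.mem_range.mpr (by omega), even_two_mul s⟩)
  have hB0 : 0 ≤ B := (Real.sqrt_nonneg _).trans (hle 0 hk)
  have h := weightedMomentNorm_le hu Finset.univ (posSemidef_gram ℝ w) (by simp) (B := B)
    (fun s hs => by
      rw [← momentTensorNorm_two_mul]
      exact hle s (by simpa using hs)) m
  rw [← momentTensorNorm_two_mul, Finset.card_univ, Fintype.card_fin] at h
  exact h.trans (mul_le_mul_of_nonneg_right (sum_choose_mul_two_pow_le hk (by omega) ht) hB0)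
end

section
/- Gaussian hypercontractivity for polynomials: if p : ℝ^d → ℝ is a polynomial of degree at most k and q > 2, then (E_{x~N(0,I)}[|p(x)|^q])^{1/q} ≤ (q−1)^{k/2} (E_{x~N(0,I)}[p(x)^2])^{1/2}. -/
open MeasureTheory ProbabilityTheory

/-- Midpoint convexity of `t ↦ t ^ s` at `1` for `s ≤ 0`. -/
lemma two_le_rpow_add_rpow {s y : ℝ} (hs : s ≤ 0) (h0 : 0 ≤ y) (h1 : y < 1) :
    2 ≤ (1 + y) ^ s + (1 - y) ^ s := by
  have hu : 0 < (1 + y) ^ s := Real.rpow_pos_of_pos (by linarith) _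
  have hv : 0 < (1 - y) ^ s := Real.rpow_pos_of_pos (by linarith) _
  have h : 1 ≤ (1 + y) ^ s * (1 - y) ^ s := by
    rw [← Real.mul_rpow (by linarith) (by linarith)]
    exact Real.one_le_rpow_of_pos_of_le_one_of_nonpos (by nlinarith) (by nlinarith) hs
  nlinarith [sq_nonneg ((1 + y) ^ s - (1 - y) ^ s)]

lemma mul_le_rpow_sub_rpow {p y : ℝ} (hp1 : 1 < p) (hp2 : p < 2) (h0 : 0 ≤ y) (h1 : y < 1) :
    2 * (p - 1) * y ≤ (1 + y) ^ (p - 1) - (1 - y) ^ (p - 1) := by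
  let f : ℝ → ℝ := fun y => (1 + y) ^ (p - 1) - (1 - y) ^ (p - 1) - 2 * (p - 1) * y
  have hd : ∀ x ∈ Set.Ico (0 : ℝ) 1, HasDerivAt f
      ((p - 1) * ((1 + x) ^ (p - 2) + (1 - x) ^ (p - 2) - 2)) x := by
    intro x hx
    have ha := ((hasDerivAt_id x).const_add 1).rpow_const (p := p - 1)
      (Or.inl (by simp only [id]; linarith [hx.1]))
    have hb := ((hasDerivAt_id x).const_sub 1).rpow_const (p := p - 1)
      (Or.inl (by simp only [id]; linarith [hx.2]))
    have hc := (hasDerivAt_id x).const_mul (2 * (p - 1))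
    convert! (ha.sub hb).sub hc using 1
    simp only [id, show p - 1 - 1 = p - 2 by ring]
    ring
  have hm : MonotoneOn f (Set.Ico 0 1) := by
    refine monotoneOn_of_deriv_nonneg (convex_Ico 0 1)
      (fun x hx => (hd x hx).continuousAt.continuousWithinAt)
      (fun x hx => (hd x (interior_subset hx)).differentiableAt.differentiableWithinAt) ?_
    intro x hx
    have hx' := interior_subset hx
    rw [(hd x hx').deriv]
    have := two_le_rpow_add_rpow (s := p - 2) (by linarith) hx'.1 hx'.2
    exact mul_nonneg (by linarith) (by linarith)
  have := hm (Set.left_mem_Ico.2 one_pos) ⟨h0, h1⟩ h0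
  simp only [f] at this
  norm_num at this
  linarith

lemma one_add_mul_sq_le_rpow_add_rpow {p y : ℝ} (hp1 : 1 < p) (hp2 : p < 2)
    (h0 : 0 ≤ y) (h1 : y ≤ 1) :
    1 + p * (p - 1) / 2 * y ^ 2 ≤ ((1 + y) ^ p + (1 - y) ^ p) / 2 := by
  let f : ℝ → ℝ := fun y => (1 + y) ^ p + (1 - y) ^ p - p * (p - 1) * y ^ 2
  have hd : ∀ x : ℝ, HasDerivAt f
      (p * ((1 + x) ^ (p - 1) - (1 - x) ^ (p - 1) - 2 * (p - 1) * x)) x := by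
    intro x
    have ha := ((hasDerivAt_id x).const_add 1).rpow_const (p := p) (Or.inr hp1.le)
    have hb := ((hasDerivAt_id x).const_sub 1).rpow_const (p := p) (Or.inr hp1.le)
    have hc := ((hasDerivAt_id x).pow 2).const_mul (p * (p - 1))
    convert! (ha.add hb).sub hc using 1
    simp only [id]
    push_cast
    ring
  have hm : MonotoneOn f (Set.Icc 0 1) := by
    refine monotoneOn_of_deriv_nonneg (convex_Icc 0 1)
      (fun x hx => (hd x).continuousAt.continuousWithinAt)
      (fun x hx => (hd x).differentiableAt.differentiableWithinAt) ?_
    intro x hx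
    rw [interior_Icc] at hx
    rw [(hd x).deriv]
    have := mul_le_rpow_sub_rpow hp1 hp2 hx.1.le hx.2
    exact mul_nonneg (by linarith) (by linarith)
  have := hm (Set.left_mem_Icc.2 zero_le_one) ⟨h0, h1⟩ h0
  simp only [f] at this
  norm_num at this
  linarith

/-- The two-point hypercontractive inequality from `L^p` to `L^2` for `1 < p < 2`. -/
lemma two_point_of_lt_two {p : ℝ} (hp1 : 1 < p) (hp2 : p < 2) (a b : ℝ) :
    (a ^ 2 + (p - 1) * b ^ 2) ^ (p / 2) ≤ (|a + b| ^ p + |a - b| ^ p) / 2 := by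
  have key : ∀ a b : ℝ, 0 ≤ b → b ≤ a →
      (a ^ 2 + (p - 1) * b ^ 2) ^ (p / 2) ≤ (|a + b| ^ p + |a - b| ^ p) / 2 := by
    intro a b hb hab
    rcases (hb.trans hab).eq_or_lt with h | ha
    · have : b = 0 := by linarith
      subst this; subst h
      simp [Real.zero_rpow (by linarith : p ≠ 0), Real.zero_rpow (by linarith : p / 2 ≠ 0)]
    have hy0 : 0 ≤ b / a := by positivity
    have hy1 : b / a ≤ 1 := (div_le_one ha).2 hab
    have e1 : a ^ 2 + (p - 1) * b ^ 2 = a ^ 2 * (1 + (p - 1) * (b / a) ^ 2) := by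
      field_simp
    have e2 : |a + b| = a * (1 + b / a) := by
      rw [abs_of_nonneg (by linarith)]; field_simp
    have e3 : |a - b| = a * (1 - b / a) := by
      rw [abs_of_nonneg (by linarith)]; field_simp
    have hz : 0 ≤ (p - 1) * (b / a) ^ 2 := mul_nonneg (by linarith) (sq_nonneg _)
    have e4 : (a ^ 2) ^ (p / 2) = a ^ p := by
      rw [← Real.rpow_natCast, ← Real.rpow_mul ha.le]
      congr 1; push_cast; ring
    rw [e1, e2, e3, Real.mul_rpow (by positivity) (by linarith), e4,
      Real.mul_rpow ha.le (by linarith), Real.mul_rpow ha.le (by linarith)]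
    have h1 := rpow_one_add_le_one_add_mul_self (s := (p - 1) * (b / a) ^ 2)
      (p := p / 2) (by linarith) (by linarith) (by linarith)
    have h2 := one_add_mul_sq_le_rpow_add_rpow hp1 hp2 hy0 hy1
    have h3 : 0 < a ^ p := Real.rpow_pos_of_pos ha _
    have h4 : (1 + (p - 1) * (b / a) ^ 2) ^ (p / 2)
        ≤ ((1 + b / a) ^ p + (1 - b / a) ^ p) / 2 := by linarith
    calc _ ≤ a ^ p * (((1 + b / a) ^ p + (1 - b / a) ^ p) / 2) := by gcongr
      _ = _ := by ring
  have key2 : ∀ a b : ℝ, 0 ≤ a → 0 ≤ b →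
      (a ^ 2 + (p - 1) * b ^ 2) ^ (p / 2) ≤ (|a + b| ^ p + |a - b| ^ p) / 2 := by
    intro a b ha hb
    rcases le_total b a with h | h
    · exact key a b hb h
    · have h1 := key b a ha h
      rw [add_comm b a, abs_sub_comm b a] at h1
      refine le_trans (Real.rpow_le_rpow ?_ ?_ (by linarith)) h1
      · exact add_nonneg (sq_nonneg _) (mul_nonneg (by linarith) (sq_nonneg _))
      · nlinarith [mul_nonneg (by linarith : 0 ≤ 2 - p) (by nlinarith : 0 ≤ b ^ 2 - a ^ 2)]
  have h := key2 |a| |b| (abs_nonneg _) (abs_nonneg _)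
  rw [sq_abs, sq_abs] at h
  refine h.trans (le_of_eq ?_)
  rcases abs_cases a with ⟨ha, -⟩ | ⟨ha, -⟩ <;> rcases abs_cases b with ⟨hb, -⟩ | ⟨hb, -⟩ <;>
    rw [ha, hb]
  · rw [← sub_eq_add_neg, sub_neg_eq_add, add_comm]
  · rw [abs_sub_comm (-a) b, sub_neg_eq_add, neg_add_eq_sub, abs_sub_comm b a, add_comm b a,
      add_comm]
  · rw [show -a + -b = -(a + b) by ring, show -a - -b = -(a - b) by ring, abs_neg, abs_neg]

/-- The two-point hypercontractive inequality from `L^2` to `L^q` for `q > 2`. -/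
lemma two_point_of_two_lt {q ρ : ℝ} (hq : 2 < q) (hρ : ρ ^ 2 = 1 / (q - 1)) (a b : ℝ) :
    (|a + ρ * b| ^ q + |a - ρ * b| ^ q) / 2 ≤ (a ^ 2 + b ^ 2) ^ (q / 2) := by
  set p : ℝ := q / (q - 1) with hp
  have hq1 : 0 < q - 1 := by linarith
  have hp1 : 1 < p := by rw [hp, lt_div_iff₀ hq1]; linarith
  have hp2 : p < 2 := by rw [hp, div_lt_iff₀ hq1]; linarith
  have hρp : ρ ^ 2 = p - 1 := by rw [hρ, hp]; field_simp; ring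
  have dual : ∀ w : ℝ, ∃ s : ℝ, w * s = |w| ^ q ∧ |s| ^ p = |w| ^ q := by
    intro w
    refine ⟨SignType.sign w * |w| ^ (q - 1), ?_, ?_⟩
    · rw [← mul_assoc, self_mul_sign]
      rcases eq_or_ne w 0 with rfl | hw
      · simp [Real.zero_rpow (by linarith : q ≠ 0)]
      · rw [← Real.rpow_one_add' (abs_nonneg _) (by linarith)]
        congr 1; ring
    · rcases eq_or_ne w 0 with rfl | hw
      · simp [Real.zero_rpow (by linarith : q ≠ 0), Real.zero_rpow (by linarith : p ≠ 0)]
      · have : |((SignType.sign w : SignType) : ℝ)| = 1 := by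
          rcases lt_or_gt_of_ne hw with h | h <;> simp [h]
        rw [abs_mul, this, one_mul, abs_of_nonneg (by positivity), ← Real.rpow_mul (abs_nonneg _)]
        congr 1
        rw [hp]; field_simp
  obtain ⟨s, hs1, hs2⟩ := dual (a + ρ * b)
  obtain ⟨t, ht1, ht2⟩ := dual (a - ρ * b)
  set X := (|a + ρ * b| ^ q + |a - ρ * b| ^ q) / 2 with hX
  have hX0 : 0 ≤ X := by positivity
  have hdual := two_point_of_lt_two hp1 hp2 ((s + t) / 2) ((s - t) / 2)
  rw [show (s + t) / 2 + (s - t) / 2 = s by ring, show (s + t) / 2 - (s - t) / 2 = t by ring,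
    hs2, ht2, ← hX] at hdual
  set Y := ((s + t) / 2) ^ 2 + (p - 1) * ((s - t) / 2) ^ 2 with hY
  have hY0 : 0 ≤ Y := add_nonneg (sq_nonneg _) (mul_nonneg (by linarith) (sq_nonneg _))
  have hY' : Y ≤ X ^ (2 / p) := by
    have := Real.rpow_le_rpow (by positivity) hdual (by positivity : 0 ≤ 2 / p)
    rwa [← Real.rpow_mul hY0, show p / 2 * (2 / p) = 1 by field_simp, Real.rpow_one] at this
  have hXeq : X = a * ((s + t) / 2) + b * (ρ * ((s - t) / 2)) := by
    rw [hX, ← hs1, ← ht1]; ring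
  have hXsq : X ^ 2 ≤ (a ^ 2 + b ^ 2) * X ^ (2 / p) := by
    calc X ^ 2 ≤ (a ^ 2 + b ^ 2) * Y := by
          have hY2 : Y = ((s + t) / 2) ^ 2 + (ρ * ((s - t) / 2)) ^ 2 := by
            rw [hY, mul_pow, hρp]
          rw [hXeq, hY2]
          nlinarith [sq_nonneg (a * (ρ * ((s - t) / 2)) - b * ((s + t) / 2))]
      _ ≤ _ := by gcongr
  rcases hX0.eq_or_lt with h | hXpos
  · rw [← h]; positivity
  have h2 : X ^ (2 / q) ≤ a ^ 2 + b ^ 2 := by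
    have hpos : 0 < X ^ (2 / p) := Real.rpow_pos_of_pos hXpos _
    refine le_of_mul_le_mul_right (le_trans (le_of_eq ?_) hXsq) hpos
    rw [← Real.rpow_add hXpos, ← Real.rpow_natCast]
    congr 1
    rw [hp]; push_cast; field_simp; ring
  have := Real.rpow_le_rpow (by positivity) h2 (by positivity : 0 ≤ q / 2)
  rwa [← Real.rpow_mul hX0, show 2 / q * (q / 2) = 1 by field_simp, Real.rpow_one] at this

/-- Minkowski's inequality for nonnegative functions on a finite probability space, in power form. -/
lemma integral_add_rpow_le {Ω : Type*} [Finite Ω] [MeasurableSpace Ω] [MeasurableSingletonClass Ω]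
    (P : Measure Ω) [IsProbabilityMeasure P] {r α β : ℝ} (hr : 1 ≤ r) (hα : 0 ≤ α) (hβ : 0 ≤ β)
    {u v : Ω → ℝ} (hu : ∀ ω, 0 ≤ u ω) (hv : ∀ ω, 0 ≤ v ω)
    (hu' : ∫ ω, u ω ^ r ∂P ≤ α ^ r) (hv' : ∫ ω, v ω ^ r ∂P ≤ β ^ r) :
    ∫ ω, (u ω + v ω) ^ r ∂P ≤ (α + β) ^ r := by
  have pos : ∀ α β : ℝ, 0 < α → 0 < β → ∫ ω, u ω ^ r ∂P ≤ α ^ r → ∫ ω, v ω ^ r ∂P ≤ β ^ r →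
      ∫ ω, (u ω + v ω) ^ r ∂P ≤ (α + β) ^ r := by
    intro α β hα hβ hu' hv'
    have hαβ : 0 < α + β := by positivity
    have hpt : ∀ ω, (u ω + v ω) ^ r ≤ (α + β) ^ r *
        (α / (α + β) * (u ω ^ r / α ^ r) + β / (α + β) * (v ω ^ r / β ^ r)) := by
      intro ω
      have hc := (convexOn_rpow hr).2 (Set.mem_Ici.2 (div_nonneg (hu ω) hα.le))
        (Set.mem_Ici.2 (div_nonneg (hv ω) hβ.le)) (by positivity : 0 ≤ α / (α + β))
        (by positivity : 0 ≤ β / (α + β)) (by field_simp)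
      simp only [smul_eq_mul] at hc
      rw [Real.div_rpow (hu ω) hα.le, Real.div_rpow (hv ω) hβ.le] at hc
      have e : u ω + v ω = (α + β) * (α / (α + β) * (u ω / α) + β / (α + β) * (v ω / β)) := by
        field_simp
      have := hu ω
      have := hv ω
      rw [e, Real.mul_rpow hαβ.le (by positivity)]
      gcongr
    calc ∫ ω, (u ω + v ω) ^ r ∂P ≤ ∫ ω, (α + β) ^ r *
        (α / (α + β) * (u ω ^ r / α ^ r) + β / (α + β) * (v ω ^ r / β ^ r)) ∂P :=
          integral_mono .of_finite .of_finite hpt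
      _ = (α + β) ^ r * (α / (α + β) * ((∫ ω, u ω ^ r ∂P) / α ^ r)
          + β / (α + β) * ((∫ ω, v ω ^ r ∂P) / β ^ r)) := by
        rw [integral_const_mul, integral_add .of_finite .of_finite, integral_const_mul,
          integral_const_mul, integral_div, integral_div]
      _ ≤ (α + β) ^ r * (α / (α + β) * 1 + β / (α + β) * 1) := by
        gcongr <;> exact div_le_one_of_le₀ (by assumption) (by positivity)
      _ = (α + β) ^ r := by field_simp
  have hcont : ContinuousAt (fun ε : ℝ => ((α + ε) + (β + ε)) ^ r) 0 := by
    apply ContinuousAt.rpow_const _ (Or.inr (by linarith))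
    fun_prop
  have hlim : Filter.Tendsto (fun ε : ℝ => ((α + ε) + (β + ε)) ^ r) (nhdsWithin 0 (Set.Ioi 0))
      (nhds ((α + β) ^ r)) := by
    have := hcont.tendsto
    simp only [add_zero] at this
    exact this.mono_left nhdsWithin_le_nhds
  refine ge_of_tendsto hlim ?_
  filter_upwards [self_mem_nhdsWithin] with ε hε
  have hε : 0 < ε := hε
  exact pos _ _ (by positivity) (by positivity)
    (hu'.trans (by gcongr; linarith)) (hv'.trans (by gcongr; linarith))

/-- A family of sign variables on a probability space, each of which can be flipped by a
measure-preserving map without changing the others. -/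
structure IsFlippable {Ω ι : Type*} [MeasurableSpace Ω] (P : Measure Ω) (x : ι → Ω → ℝ)
    (φ : ι → Ω → Ω) : Prop where
  sq_eq_one : ∀ i ω, x i ω ^ 2 = 1
  measurePreserving : ∀ i, MeasurePreserving (φ i) P P
  flip_self : ∀ i ω, x i (φ i ω) = -x i ω
  flip_of_ne : ∀ i j ω, j ≠ i → x j (φ i ω) = x j ω

/-- The Walsh polynomial with coefficients `a`, restricted to the variables in `s`. -/
def walsh {Ω ι : Type*} (x : ι → Ω → ℝ) (s : Finset ι) (a : Finset ι → ℝ) (ω : Ω) : ℝ :=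
  ∑ S ∈ s.powerset, a S * ∏ i ∈ S, x i ω

lemma walsh_insert {Ω ι : Type*} [DecidableEq ι] (x : ι → Ω → ℝ) {s : Finset ι} {i : ι}
    (hi : i ∉ s) (a : Finset ι → ℝ) (ω : Ω) :
    walsh x (insert i s) a ω = walsh x s a ω + x i ω * walsh x s (fun S => a (insert i S)) ω := by
  unfold walsh
  rw [Finset.sum_powerset_insert hi, Finset.mul_sum]
  congr 1
  refine Finset.sum_congr rfl fun S hS => ?_
  rw [Finset.prod_insert fun h => hi (Finset.mem_powerset.1 hS h)]
  ring

namespace IsFlippable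

variable {Ω ι : Type*} [MeasurableSpace Ω] {P : Measure Ω} {x : ι → Ω → ℝ} {φ : ι → Ω → Ω}

lemma walsh_flip (h : IsFlippable P x φ) {s : Finset ι} {i : ι} (hi : i ∉ s)
    (a : Finset ι → ℝ) (ω : Ω) : walsh x s a (φ i ω) = walsh x s a ω := by
  refine Finset.sum_congr rfl fun S hS => ?_
  congr 1
  refine Finset.prod_congr rfl fun j hj => h.flip_of_ne i j ω ?_
  rintro rfl
  exact hi (Finset.mem_powerset.1 hS hj)

lemma integral_eq_average [Finite Ω] [MeasurableSingletonClass Ω] [IsProbabilityMeasure P]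
    (h : IsFlippable P x φ) (i : ι) (g : Ω → ℝ) :
    ∫ ω, g ω ∂P = ∫ ω, (g ω + g (φ i ω)) / 2 ∂P := by
  have hg : ∫ ω, g (φ i ω) ∂P = ∫ ω, g ω ∂P := by
    have hm := h.measurePreserving i
    conv_rhs => rw [← hm.map_eq]
    rw [integral_map hm.measurable.aemeasurable]
    exact (measurable_of_finite g).aestronglyMeasurable
  rw [integral_div, integral_add .of_finite .of_finite, hg]
  ring

/-- Averaging over the sign `x i` of a function of two quantities not depending on it. -/
lemma integral_walsh_insert [Finite Ω] [MeasurableSingletonClass Ω] [IsProbabilityMeasure P]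
    [DecidableEq ι] (h : IsFlippable P x φ) {s : Finset ι} {i : ι} (hi : i ∉ s)
    (a : Finset ι → ℝ) (F : ℝ → ℝ) :
    ∫ ω, F (walsh x (insert i s) a ω) ∂P =
      ∫ ω, (F (walsh x s a ω + walsh x s (fun S => a (insert i S)) ω) +
        F (walsh x s a ω - walsh x s (fun S => a (insert i S)) ω)) / 2 ∂P := by
  rw [h.integral_eq_average i]
  congr 1
  ext ω
  rw [walsh_insert x hi, walsh_insert x hi, h.walsh_flip hi, h.walsh_flip hi, h.flip_self]
  rcases sq_eq_one_iff.1 (h.sq_eq_one i ω) with hx | hx <;> rw [hx]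
  · simp [sub_eq_add_neg]
  · simp [sub_eq_add_neg, add_comm]

/-- Parseval's identity. -/
lemma integral_walsh_sq [Finite Ω] [MeasurableSingletonClass Ω] [IsProbabilityMeasure P]
    (h : IsFlippable P x φ) (s : Finset ι) (a : Finset ι → ℝ) :
    ∫ ω, walsh x s a ω ^ 2 ∂P = ∑ S ∈ s.powerset, a S ^ 2 := by
  classical
  induction s using Finset.induction_on generalizing a with
  | empty => simp [walsh]
  | insert i s hi ih =>
    rw [h.integral_walsh_insert hi a (· ^ 2), Finset.sum_powerset_insert hi, ← ih, ← ih,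
      ← integral_add .of_finite .of_finite]
    congr 1
    ext ω
    ring

/-- Hypercontractivity of the noise operator on the discrete cube. -/
lemma integral_walsh_noise_le [Finite Ω] [MeasurableSingletonClass Ω] [IsProbabilityMeasure P]
    (h : IsFlippable P x φ) {q ρ : ℝ} (hq : 2 < q) (hρ : ρ ^ 2 = 1 / (q - 1))
    (s : Finset ι) (a : Finset ι → ℝ) :
    ∫ ω, |walsh x s (fun S => ρ ^ S.card * a S) ω| ^ q ∂P ≤
      (∑ S ∈ s.powerset, a S ^ 2) ^ (q / 2) := by
  classical
  have hsq : ∀ t : ℝ, (t ^ 2) ^ (q / 2) = |t| ^ q := by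
    intro t
    rw [← sq_abs, ← Real.rpow_natCast, ← Real.rpow_mul (abs_nonneg _)]
    congr 1; push_cast; ring
  induction s using Finset.induction_on generalizing a with
  | empty => simp [walsh, hsq]
  | insert i s hi ih =>
    rw [h.integral_walsh_insert hi _ (fun t => |t| ^ q), Finset.sum_powerset_insert hi]
    have hB : ∀ ω, walsh x s (fun S => ρ ^ (insert i S).card * a (insert i S)) ω =
        ρ * walsh x s (fun S => ρ ^ S.card * a (insert i S)) ω := by
      intro ω
      unfold walsh
      rw [Finset.mul_sum]
      refine Finset.sum_congr rfl fun S hS => ?_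
      beta_reduce
      rw [Finset.card_insert_of_notMem fun h => hi (Finset.mem_powerset.1 hS h)]
      ring
    simp only [hB]
    refine (integral_mono .of_finite .of_finite
      fun ω => two_point_of_two_lt hq hρ _ _).trans ?_
    refine integral_add_rpow_le P (by linarith) (by positivity) (by positivity)
      (fun ω => sq_nonneg _) (fun ω => sq_nonneg _) ?_ ?_
    · simp only [hsq]
      exact ih a
    · simp only [hsq]
      exact ih fun S => a (insert i S)

/-- Hypercontractivity for functions of degree at most `k` on the discrete cube. -/
lemma integral_walsh_le [Finite Ω] [MeasurableSingletonClass Ω] [IsProbabilityMeasure P]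
    (h : IsFlippable P x φ) {q : ℝ} (hq : 2 < q) {k : ℕ}
    (s : Finset ι) {a : Finset ι → ℝ} (ha : ∀ S, k < S.card → a S = 0) :
    ∫ ω, |walsh x s a ω| ^ q ∂P ≤
      ((q - 1) ^ k * ∫ ω, walsh x s a ω ^ 2 ∂P) ^ (q / 2) := by
  have hq1 : 0 < q - 1 := by linarith
  set ρ : ℝ := √(1 / (q - 1)) with hρ
  have hρ0 : 0 < ρ := by positivity
  have hρ2 : ρ ^ 2 = 1 / (q - 1) := Real.sq_sqrt (by positivity)
  have hn := h.integral_walsh_noise_le hq hρ2 s (fun S => (ρ ^ S.card)⁻¹ * a S)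
  have e : (fun S : Finset ι => ρ ^ S.card * ((ρ ^ S.card)⁻¹ * a S)) = a := by
    ext S; field_simp
  rw [e] at hn
  refine hn.trans (Real.rpow_le_rpow (by positivity) ?_ (by positivity))
  rw [h.integral_walsh_sq, Finset.mul_sum]
  refine Finset.sum_le_sum fun S _ => ?_
  rcases lt_or_ge k S.card with hS | hS
  · simp [ha S hS]
  · have : ((ρ ^ S.card)⁻¹) ^ 2 = (q - 1) ^ S.card := by
      rw [inv_pow, ← pow_mul, mul_comm, pow_mul, hρ2]; simp
    rw [mul_pow, this]
    gcongr
    linarith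

end IsFlippable

/-- The functions on the cube spanned by the Walsh characters of degree at most `k`. -/
def walshSpan {Ω ι : Type*} (x : ι → Ω → ℝ) (k : ℕ) : Submodule ℝ (Ω → ℝ) :=
  Submodule.span ℝ ((fun S : Finset ι => ∏ i ∈ S, x i) '' {S | S.card ≤ k})

section walshSpan

variable {Ω ι : Type*} {x : ι → Ω → ℝ}

lemma walshSpan_mono {k l : ℕ} (h : k ≤ l) : walshSpan x k ≤ walshSpan x l :=
  Submodule.span_mono (Set.image_mono fun _ hS => le_trans hS h)

lemma prod_mem_walshSpan (S : Finset ι) : ∏ i ∈ S, x i ∈ walshSpan x S.card :=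
  Submodule.subset_span ⟨S, le_refl S.card, rfl⟩

lemma one_mem_walshSpan : (1 : Ω → ℝ) ∈ walshSpan x 0 := by
  simpa using prod_mem_walshSpan (x := x) ∅

lemma var_mem_walshSpan (i : ι) : x i ∈ walshSpan x 1 := by
  simpa using prod_mem_walshSpan (x := x) {i}

lemma mul_mem_walshSpan (hx : ∀ i ω, x i ω ^ 2 = 1) {k l : ℕ} {f g : Ω → ℝ}
    (hf : f ∈ walshSpan x k) (hg : g ∈ walshSpan x l) : f * g ∈ walshSpan x (k + l) := by
  classical
  have h : walshSpan x k * walshSpan x l ≤ walshSpan x (k + l) := by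
    unfold walshSpan
    rw [Submodule.span_mul_span, Submodule.span_le]
    rintro _ ⟨_, ⟨S, hS, rfl⟩, _, ⟨T, hT, rfl⟩, rfl⟩
    have hx' : ∀ i, x i * x i = 1 := fun i => by ext ω; simpa [sq] using hx i ω
    have hS' : S.card ≤ k := hS
    have hT' : T.card ≤ l := hT
    have e : (∏ i ∈ S, x i) * ∏ i ∈ T, x i = ∏ i ∈ symmDiff S T, x i := by
      have hsd : symmDiff S T = (S \ T) ∪ (T \ S) := rfl
      have hST := Finset.prod_inter_mul_prod_sdiff S T x
      have hTS := Finset.prod_inter_mul_prod_sdiff T S x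
      rw [hsd, Finset.prod_union disjoint_sdiff_sdiff, ← hST, ← hTS, Finset.inter_comm T S,
        mul_mul_mul_comm, ← Finset.prod_mul_distrib]
      simp [hx']
    change (∏ i ∈ S, x i) * ∏ i ∈ T, x i ∈ _
    rw [e]
    refine walshSpan_mono ?_ (prod_mem_walshSpan _)
    calc (symmDiff S T).card ≤ (S ∪ T).card :=
          Finset.card_le_card (by intro i; simp [Finset.mem_symmDiff]; tauto)
      _ ≤ S.card + T.card := Finset.card_union_le _ _
      _ ≤ k + l := by omega
  exact h (Submodule.mul_mem_mul hf hg)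

lemma pow_mem_walshSpan (hx : ∀ i ω, x i ω ^ 2 = 1) {f : Ω → ℝ}
    (hf : f ∈ walshSpan x 1) (n : ℕ) : f ^ n ∈ walshSpan x n := by
  induction n with
  | zero => simpa using one_mem_walshSpan
  | succ n ih => exact pow_succ f n ▸ mul_mem_walshSpan hx ih hf

/-- A polynomial of degree at most `k` in linear forms of the signs is a function of degree at
most `k` on the cube. -/
lemma eval_mem_walshSpan (hx : ∀ i ω, x i ω ^ 2 = 1) {σ : Type*} {f : σ → Ω → ℝ}
    (hf : ∀ j, f j ∈ walshSpan x 1) (p : MvPolynomial σ ℝ) {k : ℕ} (hp : p.totalDegree ≤ k) :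
    (fun ω => MvPolynomial.eval (fun j => f j ω) p) ∈ walshSpan x k := by
  classical
  have hprod : ∀ (m : σ →₀ ℕ) (s : Finset σ),
      ∏ j ∈ s, f j ^ m j ∈ walshSpan x (∑ j ∈ s, m j) := by
    intro m s
    induction s using Finset.induction_on with
    | empty => simpa using one_mem_walshSpan
    | insert j s hj ih =>
      rw [Finset.prod_insert hj, Finset.sum_insert hj]
      exact mul_mem_walshSpan hx (pow_mem_walshSpan hx (hf j) _) ih
  have e : (fun ω => MvPolynomial.eval (fun j => f j ω) p) =
      ∑ m ∈ p.support, p.coeff m • ∏ j ∈ m.support, f j ^ m j := by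
    ext ω
    simp [MvPolynomial.eval_eq, Finset.sum_apply, Finset.prod_apply]
  rw [e]
  refine Submodule.sum_mem _ fun m hm => Submodule.smul_mem _ _ ?_
  exact walshSpan_mono ((MvPolynomial.le_totalDegree hm).trans hp) (hprod m m.support)

lemma exists_walsh_eq_of_mem_walshSpan [Fintype ι] {k : ℕ} {f : Ω → ℝ} (hf : f ∈ walshSpan x k) :
    ∃ a : Finset ι → ℝ, (∀ S, k < S.card → a S = 0) ∧ f = walsh x Finset.univ a := by
  classical
  induction hf using Submodule.span_induction with
  | mem f hf =>
    obtain ⟨S, hS, rfl⟩ := hf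
    have hS : S.card ≤ k := hS
    refine ⟨Pi.single S 1, fun T hT => Pi.single_eq_of_ne (by rintro rfl; omega) _, ?_⟩
    ext ω
    simp [walsh, Pi.single_apply]
  | zero => exact ⟨0, by simp, by ext; simp [walsh]⟩
  | add f g _ _ hf hg =>
    obtain ⟨a, ha, rfl⟩ := hf
    obtain ⟨b, hb, rfl⟩ := hg
    refine ⟨a + b, fun S hS => by simp [ha S hS, hb S hS], ?_⟩
    ext ω
    simp [walsh, add_mul, Finset.sum_add_distrib]
  | smul c f _ hf =>
    obtain ⟨a, ha, rfl⟩ := hf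
    refine ⟨c • a, fun S hS => by simp [ha S hS], ?_⟩
    ext ω
    simp [walsh, mul_assoc, Finset.mul_sum]

end walshSpan

/-- The uniform measure on `Bool`. -/
noncomputable def fairCoin : Measure Bool :=
  (2⁻¹ : ENNReal) • (Measure.dirac true + Measure.dirac false)

/-- The sign `±1` attached to a boolean. -/
def boolSign (b : Bool) : ℝ := if b then 1 else -1

instance : IsProbabilityMeasure fairCoin := by
  constructor
  simp only [fairCoin, Measure.smul_apply, Measure.add_apply, measure_univ, smul_eq_mul]
  rw [one_add_one_eq_two]
  exact ENNReal.inv_mul_cancel (by simp) (by simp)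

lemma integral_fairCoin (f : Bool → ℝ) : ∫ b, f b ∂fairCoin = (f true + f false) / 2 := by
  rw [fairCoin, integral_smul_measure, integral_add_measure .of_finite .of_finite,
    integral_dirac, integral_dirac]
  simp
  ring

lemma measurePreserving_not_fairCoin : MeasurePreserving not fairCoin fairCoin := by
  refine ⟨measurable_of_finite _, ?_⟩
  rw [fairCoin, Measure.map_smul, Measure.map_add _ _ (measurable_of_finite _),
    Measure.map_dirac' (measurable_of_finite _), Measure.map_dirac' (measurable_of_finite _)]
  simp [add_comm]

/-- The normalized sum of `n` signs. -/
noncomputable def signSum (n : ℕ) (ω : Fin n → Bool) : ℝ := (√n)⁻¹ * ∑ j, boolSign (ω j)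

/-- The law of the normalized sum of `n` independent uniform signs. -/
noncomputable def signSumLaw (n : ℕ) : ProbabilityMeasure ℝ :=
  ⟨(Measure.pi fun _ : Fin n => fairCoin).map (signSum n),
    Measure.isProbabilityMeasure_map (measurable_of_finite _).aemeasurable⟩

lemma coe_signSumLaw (n : ℕ) :
    (signSumLaw n : Measure ℝ) = (Measure.pi fun _ : Fin n => fairCoin).map (signSum n) := rfl

lemma tendsto_signSumLaw :
    Filter.Tendsto signSumLaw Filter.atTop
      (nhds (⟨gaussianReal 0 1, inferInstance⟩ : ProbabilityMeasure ℝ)) := by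
  refine ProbabilityMeasure.tendsto_iff_tendsto_charFun.2 fun t => ?_
  have hm : Measurable boolSign := measurable_of_finite _
  have h1 : ∀ n : ℕ, charFun (signSumLaw n : Measure ℝ) t =
      charFun (fairCoin.map boolSign) ((√n)⁻¹ * t) ^ n := by
    intro n
    have : IsProbabilityMeasure (fairCoin.map boolSign) :=
      Measure.isProbabilityMeasure_map hm.aemeasurable
    have hmap : (signSumLaw n : Measure ℝ) =
        ((Measure.pi fun _ : Fin n => fairCoin).map (fun ω => ∑ j, boolSign (ω j))).map
          ((√n)⁻¹ * ·) := by
      rw [coe_signSumLaw, Measure.map_map (by fun_prop) (measurable_of_finite _)]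
      rfl
    have hmap2 : (Measure.pi fun _ : Fin n => fairCoin).map (fun ω => ∑ j, boolSign (ω j)) =
        (Measure.pi fun _ : Fin n => fairCoin.map boolSign).map (fun p => ∑ j, p j) := by
      rw [← Measure.pi_map_pi (fun _ => hm.aemeasurable),
        Measure.map_map (by fun_prop) (measurable_of_finite _)]
      rfl
    rw [hmap, charFun_map_mul, hmap2, charFun_map_sum_pi_eq_prod]
    simp
  simp only [h1]
  have h2 := tendsto_charFun_inv_sqrt_mul_pow (P := fairCoin) (X := boolSign) hm.aemeasurable
    (by rw [integral_fairCoin]; simp [boolSign])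
    (by rw [integral_fairCoin]; simp [boolSign]) t
  have h3 : charFun (gaussianReal 0 1) t = Complex.exp (-t ^ 2 / 2) := by
    rw [charFun_gaussianReal]; simp [neg_div]
  change Filter.Tendsto _ _ (nhds (charFun (gaussianReal 0 1) t))
  rw [h3]
  exact h2

lemma integrable_signSumLaw (n : ℕ) {f : ℝ → ℝ} (hf : Measurable f) :
    Integrable f (signSumLaw n : Measure ℝ) := by
  rw [coe_signSumLaw, integrable_map_measure hf.aestronglyMeasurable
    (measurable_of_finite _).aemeasurable]
  exact .of_finite

lemma integral_exp_signSumLaw_le (n : ℕ) (t : ℝ) :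
    ∫ x, Real.exp (t * x) ∂(signSumLaw n : Measure ℝ) ≤ Real.exp (t ^ 2 / 2) := by
  rw [coe_signSumLaw, integral_map (measurable_of_finite _).aemeasurable
    (by fun_prop)]
  have e : ∀ ω : Fin n → Bool, Real.exp (t * signSum n ω) =
      ∏ j, Real.exp (t * (√n)⁻¹ * boolSign (ω j)) := by
    intro ω
    rw [← Real.exp_sum, ← Finset.mul_sum, signSum, mul_assoc]
  simp only [e]
  rw [integral_fintype_prod_eq_pow (fun b => Real.exp (t * (√n)⁻¹ * boolSign b)),
    integral_fairCoin, Fintype.card_fin]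
  rcases Nat.eq_zero_or_pos n with rfl | hn
  · simpa using by positivity
  have hc : (Real.exp (t * (√n)⁻¹ * boolSign true) + Real.exp (t * (√n)⁻¹ * boolSign false)) / 2 =
      Real.cosh (t * (√n)⁻¹) := by
    rw [Real.cosh_eq]; simp [boolSign]
  rw [hc]
  calc _ ≤ Real.exp ((t * (√n)⁻¹) ^ 2 / 2) ^ n := by
        gcongr
        exact Real.cosh_le_exp_half_sq _
    _ = Real.exp (t ^ 2 / 2) := by
        rw [← Real.exp_nat_mul, mul_pow, inv_pow, Real.sq_sqrt (by positivity)]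
        congr 1
        have : (n : ℝ) ≠ 0 := by positivity
        field_simp

lemma integral_abs_pow_signSumLaw_le (n m : ℕ) :
    ∫ x, |x| ^ m ∂(signSumLaw n : Measure ℝ) ≤ m.factorial * (2 * Real.exp (1 / 2)) := by
  have hpt : ∀ x : ℝ, |x| ^ m ≤ m.factorial * (Real.exp (1 * x) + Real.exp (-1 * x)) := by
    intro x
    have h := Real.pow_div_factorial_le_exp |x| (abs_nonneg x) m
    rw [div_le_iff₀ (by positivity)] at h
    have h2 : Real.exp |x| ≤ Real.exp (1 * x) + Real.exp (-1 * x) := by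
      have := Real.exp_pos x
      have := Real.exp_pos (-x)
      rcases abs_cases x with ⟨hx, -⟩ | ⟨hx, -⟩ <;> rw [hx] <;> simp <;> positivity
    rw [mul_comm] at h
    exact h.trans (by gcongr)
  calc ∫ x, |x| ^ m ∂(signSumLaw n : Measure ℝ) ≤
      ∫ x, m.factorial * (Real.exp (1 * x) + Real.exp (-1 * x)) ∂(signSumLaw n : Measure ℝ) :=
        integral_mono (integrable_signSumLaw n (by fun_prop))
          (integrable_signSumLaw n (by fun_prop)) hpt
    _ ≤ _ := by
      rw [integral_const_mul, integral_add (integrable_signSumLaw n (by fun_prop))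
          (integrable_signSumLaw n (by fun_prop))]
      have h1 := integral_exp_signSumLaw_le n 1
      have h2 := integral_exp_signSumLaw_le n (-1)
      norm_num at h1 h2 ⊢
      gcongr
      linarith

/-- The `m`-th power of the truncation of a real number to `[-R, R]`. -/
noncomputable def clipPow (R : ℝ) (hR : 0 ≤ R) (m : ℕ) : BoundedContinuousFunction ℝ ℝ :=
  BoundedContinuousFunction.ofNormedAddCommGroup (fun x => (max (-R) (min x R)) ^ m)
    (by fun_prop) (R ^ m) (by
      intro x
      rw [norm_pow, Real.norm_eq_abs]
      gcongr
      rw [abs_le]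
      exact ⟨le_max_left _ _, max_le (by linarith) (min_le_right _ _)⟩)

lemma abs_pow_sub_clipPow_le {R : ℝ} (hR : 0 < R) (m : ℕ) (x : ℝ) :
    |x ^ m - clipPow R hR.le m x| ≤ 2 / R * |x| ^ (m + 1) := by
  have e : clipPow R hR.le m x = (max (-R) (min x R)) ^ m := rfl
  rcases le_or_gt |x| R with hx | hx
  · rw [abs_le] at hx
    rw [e, min_eq_left hx.2, max_eq_right hx.1]
    simp only [sub_self, abs_zero]
    positivity
  · have h1 : |max (-R) (min x R)| ≤ |x| := by
      refine le_trans ?_ hx.le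
      rw [abs_le]
      exact ⟨le_max_left _ _, max_le (by linarith) (min_le_right _ _)⟩
    calc |x ^ m - clipPow R hR.le m x| ≤ |x ^ m| + |clipPow R hR.le m x| := abs_sub _ _
      _ ≤ |x| ^ m + |x| ^ m := by
        rw [e, abs_pow, abs_pow]
        gcongr
      _ = 2 / R * (|x| ^ m * R) := by field_simp; ring
      _ ≤ 2 / R * |x| ^ (m + 1) := by rw [pow_succ]; gcongr

/-- Weak convergence together with bounded absolute moments implies convergence of moments. -/
lemma tendsto_integral_pow_of_tendsto {μs : ℕ → ProbabilityMeasure ℝ} {μ : ProbabilityMeasure ℝ}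
    (h : Filter.Tendsto μs Filter.atTop (nhds μ)) (m : ℕ)
    (hint : ∀ n k, Integrable (fun x : ℝ => |x| ^ k) (μs n : Measure ℝ))
    (hint' : ∀ k, Integrable (fun x : ℝ => |x| ^ k) (μ : Measure ℝ))
    {C : ℝ} (hC : ∀ n, ∫ x, |x| ^ (m + 1) ∂(μs n : Measure ℝ) ≤ C) :
    Filter.Tendsto (fun n => ∫ x, x ^ m ∂(μs n : Measure ℝ)) Filter.atTop
      (nhds (∫ x, x ^ m ∂(μ : Measure ℝ))) := by
  set D := max (max C (∫ x, |x| ^ (m + 1) ∂(μ : Measure ℝ))) 1 with hD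
  have hD0 : 0 < D := lt_of_lt_of_le one_pos (le_max_right _ _)
  have bound : ∀ ν : ProbabilityMeasure ℝ,
      (∀ k, Integrable (fun x : ℝ => |x| ^ k) (ν : Measure ℝ)) →
      ∫ x, |x| ^ (m + 1) ∂(ν : Measure ℝ) ≤ D → ∀ R (hR : 0 < R),
      |∫ x, x ^ m ∂(ν : Measure ℝ) - ∫ x, clipPow R hR.le m x ∂(ν : Measure ℝ)| ≤ 2 / R * D := by
    intro ν hν hle R hR
    have hpow : Integrable (fun x : ℝ => x ^ m) (ν : Measure ℝ) := by
      refine (integrable_norm_iff (by fun_prop)).1 ?_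
      simpa using hν m
    rw [← integral_sub hpow ((clipPow R hR.le m).integrable _)]
    calc _ ≤ ∫ x, |x ^ m - clipPow R hR.le m x| ∂(ν : Measure ℝ) := abs_integral_le_integral_abs
      _ ≤ ∫ x, 2 / R * |x| ^ (m + 1) ∂(ν : Measure ℝ) :=
        integral_mono (hpow.sub ((clipPow R hR.le m).integrable _)).abs
          ((hν _).const_mul _) (abs_pow_sub_clipPow_le hR m)
      _ ≤ 2 / R * D := by
        rw [integral_const_mul]
        gcongr
  rw [Metric.tendsto_atTop]
  intro ε hε
  have hR : 0 < 8 * D / ε := by positivity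
  have hRe : 2 / (8 * D / ε) * D = ε / 4 := by field_simp; norm_num
  have hw := ProbabilityMeasure.tendsto_iff_forall_integral_tendsto.1 h
    (clipPow (8 * D / ε) hR.le m)
  obtain ⟨N, hN⟩ := (Metric.tendsto_atTop.1 hw) (ε / 4) (by positivity)
  refine ⟨N, fun n hn => ?_⟩
  have b1 := bound (μs n) (hint n) ((hC n).trans ((le_max_left _ _).trans (le_max_left _ _))) _ hR
  have b2 := bound μ hint' ((le_max_right _ _).trans (le_max_left _ _)) _ hR
  have b3 := hN n hn
  rw [hRe] at b1 b2
  rw [Real.dist_eq] at b3 ⊢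
  rw [abs_le] at b1 b2
  rw [abs_lt] at b3 ⊢
  constructor <;> linarith

lemma integrable_abs_pow_gaussianReal (k : ℕ) :
    Integrable (fun x : ℝ => |x| ^ k) (gaussianReal 0 1) := by
  have := (memLp_id_gaussianReal (μ := 0) (v := 1) k).integrable_norm_pow'
  simpa using this

lemma tendsto_integral_pow_signSumLaw (m : ℕ) :
    Filter.Tendsto (fun n => ∫ x, x ^ m ∂(signSumLaw n : Measure ℝ)) Filter.atTop
      (nhds (∫ x, x ^ m ∂(gaussianReal 0 1))) :=
  tendsto_integral_pow_of_tendsto tendsto_signSumLaw m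
    (fun n _ => integrable_signSumLaw n (by fun_prop)) integrable_abs_pow_gaussianReal
    (fun n => integral_abs_pow_signSumLaw_le n (m + 1))

section polynomialMoments

variable {d : ℕ} {μ : Measure ℝ} [IsProbabilityMeasure μ]

lemma integrable_eval_pi (hμ : ∀ k : ℕ, Integrable (fun x : ℝ => x ^ k) μ)
    (p : MvPolynomial (Fin d) ℝ) :
    Integrable (fun x => MvPolynomial.eval x p) (Measure.pi fun _ : Fin d => μ) := by
  simp only [MvPolynomial.eval_eq']
  exact integrable_finsetSum _ fun m _ =>
    (Integrable.fintype_prod (f := fun i (t : ℝ) => t ^ m i) fun i => hμ (m i)).const_mul _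

lemma integral_eval_pi (hμ : ∀ k : ℕ, Integrable (fun x : ℝ => x ^ k) μ)
    (p : MvPolynomial (Fin d) ℝ) :
    ∫ x, MvPolynomial.eval x p ∂(Measure.pi fun _ : Fin d => μ) =
      ∑ m ∈ p.support, p.coeff m * ∏ i, ∫ t, t ^ m i ∂μ := by
  simp only [MvPolynomial.eval_eq']
  rw [integral_finsetSum _ fun m _ =>
    (Integrable.fintype_prod (f := fun i (t : ℝ) => t ^ m i) fun i => hμ (m i)).const_mul _]
  refine Finset.sum_congr rfl fun m _ => ?_
  rw [integral_const_mul, integral_fintype_prod_eq_prod (fun i (t : ℝ) => t ^ m i)]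

end polynomialMoments

lemma integrable_pow_gaussianReal (k : ℕ) :
    Integrable (fun x : ℝ => x ^ k) (gaussianReal 0 1) := by
  refine (integrable_norm_iff (by fun_prop)).1 ?_
  simpa using integrable_abs_pow_gaussianReal k

/-- Polynomial moments of normalized sums of signs converge to Gaussian moments. -/
lemma tendsto_integral_eval_signSumLaw {d : ℕ} (p : MvPolynomial (Fin d) ℝ) :
    Filter.Tendsto (fun n => ∫ x, MvPolynomial.eval x p
      ∂(Measure.pi fun _ : Fin d => (signSumLaw n : Measure ℝ))) Filter.atTop
      (nhds (∫ x, MvPolynomial.eval x p ∂(stdGaussian d))) := by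
  unfold _root_.stdGaussian
  rw [integral_eval_pi integrable_pow_gaussianReal]
  simp only [fun n => integral_eval_pi (d := d)
    (fun k => integrable_signSumLaw n (f := fun x => x ^ k) (by fun_prop)) p]
  exact tendsto_finsetSum _ fun m _ => (tendsto_finsetProd _ fun i _ =>
    tendsto_integral_pow_signSumLaw (m i)).const_mul _

/-- Products of normalized sums of signs converge weakly to the standard Gaussian measure. -/
lemma tendsto_integral_boundedContinuous_signSumLaw {d : ℕ}
    (f : BoundedContinuousFunction (Fin d → ℝ) ℝ) :
    Filter.Tendsto (fun n => ∫ x, f x ∂(Measure.pi fun _ : Fin d => (signSumLaw n : Measure ℝ)))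
      Filter.atTop (nhds (∫ x, f x ∂(stdGaussian d))) := by
  have h : Filter.Tendsto (fun n => ProbabilityMeasure.pi fun _ : Fin d => signSumLaw n)
      Filter.atTop (nhds (ProbabilityMeasure.pi fun _ : Fin d => ⟨gaussianReal 0 1, inferInstance⟩)) :=
    ((ProbabilityMeasure.continuous_pi (α := fun _ : Fin d => ℝ)).tendsto _).comp
      (tendsto_pi_nhds.2 fun _ => tendsto_signSumLaw)
  exact ProbabilityMeasure.tendsto_iff_forall_integral_tendsto.1 h f

/-- The signs on a product of cubes are flippable. -/
lemma isFlippable_boolSign (d n : ℕ) :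
    IsFlippable (Measure.pi fun _ : Fin d => Measure.pi fun _ : Fin n => fairCoin)
      (fun (i : Fin d × Fin n) ω => boolSign (ω i.1 i.2))
      (fun i ω a b => (if (a, b) = i then not else id) (ω a b)) where
  sq_eq_one i ω := by
    rcases h : ω i.1 i.2 <;> simp [boolSign]
  measurePreserving i := by
    refine measurePreserving_pi (f := fun a (ω : Fin n → Bool) b =>
      (if (a, b) = i then not else id) (ω b)) _ _ fun a => ?_
    refine measurePreserving_pi (f := fun b => if (a, b) = i then not else id) _ _ fun b => ?_
    split_ifs
    · exact measurePreserving_not_fairCoin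
    · exact MeasurePreserving.id _
  flip_self i ω := by
    rcases h : ω i.1 i.2 <;> simp [boolSign, h]
  flip_of_ne i j ω hij := by
    simp [hij]

/-- Hypercontractivity for polynomials in normalized sums of signs. -/
lemma integral_abs_eval_rpow_signSumLaw_le {d k : ℕ} {q : ℝ} (hq : 2 < q)
    (p : MvPolynomial (Fin d) ℝ) (hp : p.totalDegree ≤ k) (n : ℕ) :
    Integrable (fun x => |MvPolynomial.eval x p| ^ q)
      (Measure.pi fun _ : Fin d => (signSumLaw n : Measure ℝ)) ∧
    ∫ x, |MvPolynomial.eval x p| ^ q ∂(Measure.pi fun _ : Fin d => (signSumLaw n : Measure ℝ)) ≤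
      ((q - 1) ^ k * ∫ x, MvPolynomial.eval x p ^ 2
        ∂(Measure.pi fun _ : Fin d => (signSumLaw n : Measure ℝ))) ^ (q / 2) := by
  have hm : Measurable fun (ω : Fin d → Fin n → Bool) i => signSum n (ω i) :=
    measurable_of_finite _
  have hmap : (Measure.pi fun _ : Fin d => (signSumLaw n : Measure ℝ)) =
      (Measure.pi fun _ : Fin d => Measure.pi fun _ : Fin n => fairCoin).map
        (fun ω i => signSum n (ω i)) := by
    have : IsProbabilityMeasure ((Measure.pi fun _ : Fin n => fairCoin).map (signSum n)) :=
      (signSumLaw n).2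
    simp only [coe_signSumLaw]
    rw [Measure.pi_map_pi fun _ => (measurable_of_finite (signSum n)).aemeasurable]
  have hev : Continuous fun x : Fin d → ℝ => MvPolynomial.eval x p :=
    MvPolynomial.continuous_eval p
  have hev_sq : Continuous fun x : Fin d → ℝ => MvPolynomial.eval x p ^ 2 := hev.pow 2
  have hc : Continuous fun x : Fin d → ℝ => |MvPolynomial.eval x p| ^ q :=
    hev.abs.rpow_const fun _ => Or.inr (by linarith)
  have hflip := isFlippable_boolSign d n
  have hspan := eval_mem_walshSpan hflip.sq_eq_one
    (f := fun (i : Fin d) (ω : Fin d → Fin n → Bool) => signSum n (ω i)) (fun i => by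
      have e : (fun ω : Fin d → Fin n → Bool => signSum n (ω i)) =
          (√n)⁻¹ • ∑ j, fun ω : Fin d → Fin n → Bool => boolSign (ω i j) := by
        ext ω
        simp [signSum]
      rw [e]
      exact Submodule.smul_mem _ _ (Submodule.sum_mem _ fun j _ =>
        var_mem_walshSpan (x := fun (i : Fin d × Fin n) (ω : Fin d → Fin n → Bool) =>
          boolSign (ω i.1 i.2)) (i, j))) p hp
  obtain ⟨a, ha, hfa⟩ := exists_walsh_eq_of_mem_walshSpan hspan
  have hmain := hflip.integral_walsh_le hq Finset.univ ha
  rw [← hfa] at hmain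
  rw [hmap]
  refine ⟨?_, ?_⟩
  · rw [integrable_map_measure hc.aestronglyMeasurable hm.aemeasurable]
    exact .of_finite
  · rw [integral_map hm.aemeasurable hc.aestronglyMeasurable,
      integral_map hm.aemeasurable hev_sq.aestronglyMeasurable]
    exact hmain

/-- Weak form of Gaussian hypercontractivity, with a truncated left-hand side. -/
lemma integral_min_abs_eval_rpow_le {d k : ℕ} {q : ℝ} (hq : 2 < q)
    (p : MvPolynomial (Fin d) ℝ) (hp : p.totalDegree ≤ k) (M : ℕ) :
    ∫ x, min (|MvPolynomial.eval x p| ^ q) M ∂(stdGaussian d) ≤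
      ((q - 1) ^ k * ∫ x, MvPolynomial.eval x p ^ 2 ∂(stdGaussian d)) ^ (q / 2) := by
  have hc : Continuous fun x : Fin d → ℝ => |MvPolynomial.eval x p| ^ q :=
    (MvPolynomial.continuous_eval p).abs.rpow_const fun _ => Or.inr (by linarith)
  let f : BoundedContinuousFunction (Fin d → ℝ) ℝ :=
    .ofNormedAddCommGroup (fun x => min (|MvPolynomial.eval x p| ^ q) (M : ℝ))
      (hc.min continuous_const) M (fun x => by
        rw [Real.norm_of_nonneg (le_min (by positivity) (by positivity))]
        exact min_le_right _ _)
  have hsq := tendsto_integral_eval_signSumLaw (p ^ 2)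
  simp only [map_pow] at hsq
  refine le_of_tendsto_of_tendsto' (tendsto_integral_boundedContinuous_signSumLaw f)
    ((hsq.const_mul ((q - 1) ^ k)).rpow_const (Or.inr (by linarith : 0 ≤ q / 2))) fun n => ?_
  obtain ⟨hint, hle⟩ := integral_abs_eval_rpow_signSumLaw_le hq p hp n
  exact (integral_mono (f.integrable _) hint fun x => min_le_left _ _).trans hle

lemma integral_abs_eval_rpow_le {d k : ℕ} {q : ℝ} (hq : 2 < q)
    (p : MvPolynomial (Fin d) ℝ) (hp : p.totalDegree ≤ k) :
    ∫ x, |MvPolynomial.eval x p| ^ q ∂(stdGaussian d) ≤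
      ((q - 1) ^ k * ∫ x, MvPolynomial.eval x p ^ 2 ∂(stdGaussian d)) ^ (q / 2) := by
  have hc : Continuous fun x : Fin d → ℝ => |MvPolynomial.eval x p| ^ q :=
    (MvPolynomial.continuous_eval p).abs.rpow_const fun _ => Or.inr (by linarith)
  by_cases hint : Integrable (fun x => |MvPolynomial.eval x p| ^ q) (stdGaussian d)
  · refine le_of_tendsto' (tendsto_integral_of_dominated_convergence
      (F := fun (M : ℕ) x => min (|MvPolynomial.eval x p| ^ q) (M : ℝ)) _
      (fun M => (hc.min continuous_const).aestronglyMeasurable) hint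
      (fun M => .of_forall fun x => ?_) (.of_forall fun x => ?_))
      (integral_min_abs_eval_rpow_le hq p hp)
    · rw [Real.norm_of_nonneg (le_min (by positivity) (by positivity))]
      exact min_le_left _ _
    · refine tendsto_const_nhds.congr' ?_
      obtain ⟨N, hN⟩ := exists_nat_ge (|MvPolynomial.eval x p| ^ q)
      filter_upwards [Filter.eventually_ge_atTop N] with M hM
      exact (min_eq_left (hN.trans (by exact_mod_cast hM))).symm
  · rw [integral_undef hint]
    have : 0 ≤ q - 1 := by linarith
    positivity

/-- Gaussian hypercontractivity: if `p : ℝ^d → ℝ` is a polynomial of degree at most `k`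
and `q > 2`, then `‖p‖_q ≤ (q−1)^{k/2} ‖p‖₂` with respect to `N(0, I_d)`. -/
theorem gaussian_hypercontractivity (d k : ℕ) (q : ℝ) (hq : 2 < q)
    (p : MvPolynomial (Fin d) ℝ) (hp : p.totalDegree ≤ k) :
    (∫ x, |MvPolynomial.eval x p| ^ q ∂(stdGaussian d)) ^ (1 / q) ≤
      (q - 1) ^ ((k : ℝ) / 2) *
        Real.sqrt (∫ x, (MvPolynomial.eval x p) ^ 2 ∂(stdGaussian d)) := by
  have hq1 : 0 ≤ q - 1 := by linarith
  have h := Real.rpow_le_rpow (by positivity) (integral_abs_eval_rpow_le hq p hp)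
    (by positivity : 0 ≤ 1 / q)
  refine h.trans (le_of_eq ?_)
  rw [← Real.rpow_mul (by positivity), show q / 2 * (1 / q) = 1 / 2 by field_simp,
    Real.mul_rpow (by positivity) (by positivity), Real.sqrt_eq_rpow, ← Real.rpow_natCast,
    ← Real.rpow_mul hq1, mul_one_div]
end
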